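/- arXiv:1209.5415 — 4 statements merged into one kernel-verified Lean document; each statement's English description precedes it below -/
import Mathlib

section
/- Let $s>0$, $M\ge 1$, and let $f_1,\dots,f_M,h_1,\dots,h_M:\mathbb{R}\to\mathbb{C}$ be smooth on a neighborhood of $[-s,s]$ with $\sum_{i=1}^M f_i(\lambda)h_i(\lambda)=0$ for all $\lambda$. Let $K$ be the integral operator on $L^2((-s,s))$ with (continuous) kernel $K(\lambda,\mu)=\frac{\sum_{i=1}^M f_i(\lambda)h_i(\mu)}{\lambda-\mu}$, and let $K^t$ be the operator with kernel $K(\mu,\lambda)$. If $I-K$ has a bounded inverse, then $(I-K)^{-1}=I+R$, where $R$ is the integral operator whose kernel is $R(\lambda,\mu)=\frac{\sum_{i=1}^M F_i(\lambda)H_i(\mu)}{\lambda-\mu}$ with $F_i:=(I-K)^{-1}f_i$ and $H_i:=(I-K^t)^{-1}h_i$ (which admit continuous representatives on $[-s,s]$), and moreover $\sum_{i=1}^M F_i(\lambda)H_i(\lambda)=0$ for all $\lambda\in(-s,s)$. -/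
noncomputable section
open MeasureTheory Filter Topology

/-- The integrable kernel `K(λ,μ) = (∑ᵢ fᵢ(λ)hᵢ(μ))/(λ-μ)`, extended to the diagonal
by its continuous value `∑ᵢ fᵢ'(λ)hᵢ(λ)` (valid when `∑ᵢ fᵢhᵢ ≡ 0`). -/
def intKernel {M : ℕ} (f h : Fin M → ℝ → ℂ) (lam mu : ℝ) : ℂ :=
  if lam = mu then ∑ i, deriv (f i) lam * h i lam
  else (∑ i, f i lam * h i mu) / (((lam:ℝ):ℂ) - ((mu:ℝ):ℂ))

open ComplexConjugate in
lemma aux_inner {m : Measure ℝ} {g : ℝ → ℂ}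
    (hgc : MemLp (fun x => conj (g x)) 2 m) (φ : Lp ℂ 2 m) :
    inner ℂ hgc.toLp φ = ∫ x, g x * φ x ∂m := by
  rw [MeasureTheory.L2.inner_def]
  refine integral_congr_ae ?_
  filter_upwards [hgc.coeFn_toLp] with x hx
  rw [hx]; simp [RCLike.inner_apply, mul_comm]

open ComplexConjugate in
lemma aux_inner' {m : Measure ℝ} (g : Lp ℂ 2 m) (φ : Lp ℂ 2 m) :
    inner ℂ g φ = ∫ x, conj (g x) * φ x ∂m := by
  rw [MeasureTheory.L2.inner_def]
  refine integral_congr_ae ?_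
  filter_upwards with x
  simp [RCLike.inner_apply, mul_comm]

lemma aux_X {m : Measure ℝ} [IsFiniteMeasure m] (S : ℝ) (hS : ∀ᵐ x ∂m, |x| ≤ S) :
    ∃ X : Lp ℂ 2 m →L[ℂ] Lp ℂ 2 m, ∀ φ : Lp ℂ 2 m, (X φ : ℝ → ℂ) =ᵐ[m] fun x => (x : ℂ) * φ x := by
  have hx : MemLp (fun x : ℝ => (x : ℂ)) ⊤ m := by
    refine memLp_top_of_bound (by fun_prop) S ?_
    filter_upwards [hS] with x hx
    simpa using hx
  refine ⟨(ContinuousLinearMap.mul ℂ ℂ).holderL m ⊤ 2 2 hx.toLp, fun φ => ?_⟩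
  filter_upwards [(ContinuousLinearMap.mul ℂ ℂ).coeFn_holder (r := 2) hx.toLp φ, hx.coeFn_toLp]
    with x h1 h2
  rw [ContinuousLinearMap.holderL_apply_apply, h1, h2]
  rfl

open ComplexConjugate in
/-- Existence of the resolvent data, in an abstract form. -/
lemma aux_core {m : Measure ℝ} [IsFiniteMeasure m] {M : ℕ} (f h : Fin M → ℝ → ℂ) (B C S : ℝ)
    (hfm : ∀ i, Measurable (f i)) (hhm : ∀ i, Measurable (h i))
    (hfb : ∀ i x, ‖f i x‖ ≤ B) (hhb : ∀ i x, ‖h i x‖ ≤ B)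
    (k : ℝ → ℝ → ℂ) (hkm : Measurable (Function.uncurry k)) (hkb : ∀ x y, ‖k x y‖ ≤ C)
    (hk : ∀ x y : ℝ, ((x : ℂ) - (y : ℂ)) * k x y = ∑ i, f i x * h i y)
    (hS : ∀ᵐ x ∂m, |x| ≤ S)
    (T Tinv : Lp ℂ 2 m →L[ℂ] Lp ℂ 2 m)
    (hT : ∀ φ : Lp ℂ 2 m, (T φ : ℝ → ℂ) =ᵐ[m] fun x => ∫ y, k x y * φ y ∂m)
    (hTinv₁ : (1 - T) * Tinv = 1) (hTinv₂ : Tinv * (1 - T) = 1) :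
    ∃ (u v : Fin M → ℝ → ℂ) (r : ℝ → ℝ → ℂ),
      (∀ i, MemLp (u i) 2 m) ∧ (∀ i, MemLp (v i) 2 m) ∧ (∀ x, MemLp (r x) 2 m) ∧
      (∀ i, u i =ᵐ[m] fun x => f i x + ∫ y, k x y * u i y ∂m) ∧
      (∀ i, v i =ᵐ[m] fun y => h i y + ∫ x, k x y * v i x ∂m) ∧
      (∀ x : ℝ, ∀ᵐ y : ℝ ∂m, ((x : ℂ) - (y : ℂ)) * r x y
        = ∑ i, (f i x + ∫ z, k x z * u i z ∂m) * v i y) ∧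
      ∀ φ : Lp ℂ 2 m, ((Tinv - 1) φ : Lp ℂ 2 m) =ᵐ[m] fun x => ∫ y, r x y * φ y ∂m := by
  obtain ⟨X, hX⟩ := aux_X (m := m) S hS
  have hk1 : ∀ x, Measurable (fun y => k x y) := fun x => hkm.comp measurable_prodMk_left
  have hk2 : ∀ y, Measurable (fun x => k x y) := fun y => hkm.comp measurable_prodMk_right
  have mf : ∀ i, MemLp (f i) 2 m := fun i =>
    MemLp.of_bound (hfm i).aestronglyMeasurable B (ae_of_all _ (hfb i))
  have mh : ∀ i, MemLp (fun x => conj (h i x)) 2 m := fun i =>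
    MemLp.of_bound (Complex.continuous_conj.measurable.comp (hhm i)).aestronglyMeasurable B
      (ae_of_all _ (by simpa using hhb i))
  have mk : ∀ x, MemLp (fun y => conj (k x y)) 2 m := fun x =>
    MemLp.of_bound (Complex.continuous_conj.measurable.comp (hk1 x)).aestronglyMeasurable C
      (ae_of_all _ (by simpa using hkb x))
  have int2 : ∀ φ : Lp ℂ 2 m, Integrable φ m := fun φ => (Lp.memLp φ).integrable (by norm_num)
  have intk : ∀ x (φ : Lp ℂ 2 m), Integrable (fun y => k x y * φ y) m := fun x φ =>
    (int2 φ).bdd_mul (c := C) (hk1 x).aestronglyMeasurable (ae_of_all _ (hkb x))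
  have inth : ∀ i (φ : Lp ℂ 2 m), Integrable (fun y => h i y * φ y) m := fun i φ =>
    (int2 φ).bdd_mul (c := B) (hhm i).aestronglyMeasurable (ae_of_all _ (hhb i))
  have hTT : ∀ φ, Tinv φ = φ + T (Tinv φ) := by
    intro φ
    have := congrArg (fun A : Lp ℂ 2 m →L[ℂ] Lp ℂ 2 m => A φ) hTinv₁
    simp at this
    rw [sub_eq_iff_eq_add] at this
    exact this
  have hTT' : ∀ φ, Tinv (φ - T φ) = φ := by
    intro φ
    have := congrArg (fun A : Lp ℂ 2 m →L[ℂ] Lp ℂ 2 m => A φ) hTinv₂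
    simpa using this
  -- inner products with X
  have hXsymm : ∀ φ ψ : Lp ℂ 2 m, inner ℂ (X φ) ψ = inner ℂ φ (X ψ) := by
    intro φ ψ
    rw [aux_inner', aux_inner']
    refine integral_congr_ae ?_
    filter_upwards [hX φ, hX ψ] with x h1 h2
    rw [h1, h2]; simp; ring
  -- commutator with T
  have hcomm : ∀ ψ, X (T ψ) - T (X ψ) = ∑ i, (inner ℂ (mh i).toLp ψ : ℂ) • (mf i).toLp := by
    intro ψ
    apply Lp.ext
    have hsum : ((∑ i, (inner ℂ (mh i).toLp ψ : ℂ) • (mf i).toLp : Lp ℂ 2 m) : ℝ → ℂ) =ᵐ[m]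
        fun x => ∑ i, (inner ℂ (mh i).toLp ψ : ℂ) * f i x := by
      refine (Lp.coeFn_fun_finsetSum _ _).trans ?_
      have : ∀ i, ((inner ℂ (mh i).toLp ψ : ℂ) • (mf i).toLp : Lp ℂ 2 m) =ᵐ[m]
          fun x => (inner ℂ (mh i).toLp ψ : ℂ) * f i x := by
        intro i
        filter_upwards [Lp.coeFn_smul (inner ℂ (mh i).toLp ψ : ℂ) (mf i).toLp,
          (mf i).coeFn_toLp] with x h1 h2
        rw [h1, Pi.smul_apply, h2, smul_eq_mul]
      filter_upwards [ae_all_iff.2 this] with x hx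
      exact Finset.sum_congr rfl fun i _ => hx i
    filter_upwards [hsum, Lp.coeFn_sub (X (T ψ)) (T (X ψ)), hX (T ψ), hT ψ, hT (X ψ)]
      with x h1 h2 h3 h4 h5
    rw [h1, h2, Pi.sub_apply, h3, h4, h5]
    have e1 : ∫ y, k x y * (X ψ) y ∂m = ∫ y, k x y * ((y : ℂ) * ψ y) ∂m := by
      refine integral_congr_ae ?_
      filter_upwards [hX ψ] with y hy
      rw [hy]
    have e2 : Integrable (fun y => k x y * ((y : ℂ) * ψ y)) m := by
      refine (intk x (X ψ)).congr ?_
      filter_upwards [hX ψ] with y hy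
      rw [hy]
    rw [e1, ← integral_const_mul, ← integral_sub ((intk x ψ).const_mul _) e2]
    calc _ = ∫ y, ∑ i, f i x * (h i y * ψ y) ∂m := by
          refine integral_congr_ae (ae_of_all _ fun y => ?_)
          have := congrArg (· * ψ y) (hk x y)
          simp only [Finset.sum_mul, mul_assoc] at this
          simp only
          rw [← this]; ring
      _ = _ := by
          rw [integral_finsetSum _ (fun i _ => (inth i ψ).const_mul _)]
          refine Finset.sum_congr rfl fun i _ => ?_
          rw [integral_const_mul, aux_inner, mul_comm]
  -- commutator with Tinv
  have hcomm' : ∀ φ, Tinv (X φ) = X (Tinv φ) -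
      ∑ i, (inner ℂ (mh i).toLp (Tinv φ) : ℂ) • Tinv (mf i).toLp := by
    intro φ
    set ψ := Tinv φ with hψ
    have e : φ = ψ - T ψ := by rw [eq_sub_iff_add_eq, hψ]; exact (hTT φ).symm
    have : X φ = (X ψ - T (X ψ)) - ∑ i, (inner ℂ (mh i).toLp ψ : ℂ) • (mf i).toLp := by
      rw [← hcomm ψ, e, map_sub]; abel
    rw [this, map_sub, hTT', map_sum]
    simp only [map_smul]
  -- the transposed operator
  set A := ContinuousLinearMap.adjoint Tinv with hA
  let G : Fin M → Lp ℂ 2 m := fun i => A (mh i).toLp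
  let u : Fin M → Lp ℂ 2 m := fun i => Tinv (mf i).toLp
  have hGint : ∀ i (φ : Lp ℂ 2 m), inner ℂ (G i) φ = inner ℂ (mh i).toLp (Tinv φ) := fun i φ =>
    ContinuousLinearMap.adjoint_inner_left _ _ _
  have hadj : ∀ g : Lp ℂ 2 m, (ContinuousLinearMap.adjoint T g : ℝ → ℂ) =ᵐ[m]
      fun y => conj (∫ x, k x y * conj (g x) ∂m) := by
    intro g
    have sm : StronglyMeasurable (fun y => ∫ x, k x y * conj (g x) ∂m) := by
      refine StronglyMeasurable.integral_prod_left (f := fun x y => k x y * conj (g x)) ?_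
      refine Measurable.stronglyMeasurable ?_
      have hg : Measurable (fun x => conj (g x)) :=
        Complex.continuous_conj.measurable.comp (Lp.stronglyMeasurable g).measurable
      exact hkm.mul (hg.comp measurable_fst)
    have gi : Integrable (fun x => conj (g x)) m := by
      refine (int2 g).congr' ?_ ?_
      · exact (Complex.continuous_conj.measurable.comp
          (Lp.stronglyMeasurable g).measurable).aestronglyMeasurable
      · exact ae_of_all _ (by simp)
    have ml : MemLp (fun y => conj (∫ x, k x y * conj (g x) ∂m)) 2 m := by
      refine MemLp.of_bound
        (Complex.continuous_conj.measurable.comp sm.measurable).aestronglyMeasurable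
        (∫ x, C * ‖g x‖ ∂m) (ae_of_all _ fun y => ?_)
      rw [RCLike.norm_conj]
      refine norm_integral_le_of_norm_le ((int2 g).norm.const_mul C) (ae_of_all _ fun x => ?_)
      rw [norm_mul, RCLike.norm_conj]
      exact mul_le_mul_of_nonneg_right (hkb x y) (norm_nonneg _)
    have : ContinuousLinearMap.adjoint T g = ml.toLp := by
      refine ext_inner_right ℂ fun φ => ?_
      rw [ContinuousLinearMap.adjoint_inner_left, aux_inner ml, aux_inner']
      calc _ = ∫ x, ∫ y, conj (g x) * (k x y * φ y) ∂m ∂m := by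
            refine integral_congr_ae ?_
            filter_upwards [hT φ] with x hx
            rw [hx, integral_const_mul]
        _ = ∫ y, ∫ x, conj (g x) * (k x y * φ y) ∂m ∂m := by
            refine integral_integral_swap ?_
            have := (gi.mul_prod (int2 φ)).bdd_mul (c := C)
              (f := Function.uncurry k) hkm.aestronglyMeasurable
              (ae_of_all _ fun p => hkb p.1 p.2)
            refine this.congr (ae_of_all _ fun p => ?_)
            simp only [Function.uncurry]; ring
        _ = _ := by
            refine integral_congr_ae (ae_of_all _ fun y => ?_)
            simp only
            rw [← integral_mul_const]
            refine integral_congr_ae (ae_of_all _ fun x => ?_)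
            simp only; ring
    rw [this]
    exact ml.coeFn_toLp
  have hGeq : ∀ i, G i = (mh i).toLp + ContinuousLinearMap.adjoint T (G i) := by
    intro i
    refine ext_inner_right ℂ fun φ => ?_
    rw [inner_add_left, ContinuousLinearMap.adjoint_inner_left T, hGint i φ, hGint i (T φ),
      ← inner_add_right]
    congr 1
    have := hTT' φ
    rw [map_sub, sub_eq_iff_eq_add] at this
    exact this
  have conjm : ∀ g : Lp ℂ 2 m, MemLp (fun x => conj (g x)) 2 m := fun g =>
    (Lp.memLp g).congr_norm (Complex.continuous_conj.measurable.comp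
          (Lp.stronglyMeasurable g).measurable).aestronglyMeasurable (ae_of_all _ (by simp))
  have hFx : ∀ x i, (inner ℂ (mk x).toLp (u i) : ℂ) = ∫ y, k x y * u i y ∂m := fun x i =>
    aux_inner (mk x) _
  refine ⟨fun i => u i, fun i x => conj (G i x), fun x y => conj (A (mk x).toLp y),
    fun i => Lp.memLp _, fun i => conjm _, fun x => conjm _, fun i => ?_, fun i => ?_,
    fun x => ?_, fun φ => ?_⟩
  · have : u i = (mf i).toLp + T (u i) := hTT _
    have h0 : (u i : ℝ → ℂ) =ᵐ[m] ((mf i).toLp + T (u i) : Lp ℂ 2 m) := by rw [← this]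
    filter_upwards [h0, Lp.coeFn_add (mf i).toLp (T (u i)), (mf i).coeFn_toLp, hT (u i)]
      with x e0 e1 e2 e3
    rw [e0, e1, Pi.add_apply, e2, e3]
  · have h0 : (G i : ℝ → ℂ) =ᵐ[m] ((mh i).toLp + ContinuousLinearMap.adjoint T (G i) : Lp ℂ 2 m) := by
      rw [← hGeq i]
    filter_upwards [h0, Lp.coeFn_add (mh i).toLp (ContinuousLinearMap.adjoint T (G i)),
      (mh i).coeFn_toLp, hadj (G i)] with x e0 e1 e2 e3
    rw [e0, e1, Pi.add_apply, e2, e3]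
    simp
  · have key : (conj (x : ℂ)) • A (mk x).toLp - X (A (mk x).toLp)
        = ∑ i, conj (f i x + ∫ y, k x y * u i y ∂m) • G i := by
      refine ext_inner_right ℂ fun φ => ?_
      have e1 : (x : ℂ) • (mk x).toLp - X (mk x).toLp = ∑ i, conj (f i x) • (mh i).toLp := by
        apply Lp.ext
        have hsum : ((∑ i, conj (f i x) • (mh i).toLp : Lp ℂ 2 m) : ℝ → ℂ) =ᵐ[m]
            fun y => ∑ i, conj (f i x) * conj (h i y) := by
          refine (Lp.coeFn_fun_finsetSum _ _).trans ?_
          have : ∀ i, (conj (f i x) • (mh i).toLp : Lp ℂ 2 m) =ᵐ[m]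
              fun y => conj (f i x) * conj (h i y) := by
            intro i
            filter_upwards [Lp.coeFn_smul (conj (f i x)) (mh i).toLp,
              (mh i).coeFn_toLp] with x h1 h2
            rw [h1, Pi.smul_apply, h2, smul_eq_mul]
          filter_upwards [ae_all_iff.2 this] with x hx
          exact Finset.sum_congr rfl fun i _ => hx i
        filter_upwards [hsum, Lp.coeFn_sub ((x : ℂ) • (mk x).toLp) (X (mk x).toLp),
          Lp.coeFn_smul (x : ℂ) (mk x).toLp, hX (mk x).toLp, (mk x).coeFn_toLp]
          with y h1 h2 h3 h4 h5
        rw [h1, h2, Pi.sub_apply, h3, Pi.smul_apply, h4, h5]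
        have := congrArg conj (hk x y)
        simp only [map_mul, map_sub, map_sum, Complex.conj_ofReal] at this
        rw [← this, smul_eq_mul]; ring
      have e2 : (inner ℂ (mk x).toLp ((x : ℂ) • Tinv φ - X (Tinv φ)) : ℂ) =
          ∑ i, f i x * inner ℂ (mh i).toLp (Tinv φ) := by
        rw [inner_sub_right, ← hXsymm, inner_smul_right, ← Complex.conj_ofReal,
          ← inner_smul_left, ← inner_sub_left, e1, sum_inner]
        simp only [inner_smul_left, Complex.conj_conj]
      rw [inner_sub_left, hXsymm, inner_smul_left, hA, ContinuousLinearMap.adjoint_inner_left,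
        ContinuousLinearMap.adjoint_inner_left, hcomm', Complex.conj_conj, inner_sub_right,
        sum_inner]
      rw [inner_sub_right, inner_smul_right] at e2
      rw [← sub_add, e2, inner_sum, ← Finset.sum_add_distrib]
      refine Finset.sum_congr rfl fun i _ => ?_
      rw [inner_smul_right, inner_smul_left, Complex.conj_conj, hFx, hGint]
      ring
    have hsum : ((∑ i, conj (f i x + ∫ y, k x y * u i y ∂m) • G i : Lp ℂ 2 m) : ℝ → ℂ) =ᵐ[m]
        fun y => ∑ i, conj (f i x + ∫ y, k x y * u i y ∂m) * G i y := by
      refine (Lp.coeFn_fun_finsetSum _ _).trans ?_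
      have : ∀ i, (conj (f i x + ∫ y, k x y * u i y ∂m) • G i : Lp ℂ 2 m) =ᵐ[m]
          fun y => conj (f i x + ∫ y, k x y * u i y ∂m) * G i y := by
        intro i
        filter_upwards [Lp.coeFn_smul (conj (f i x + ∫ y, k x y * u i y ∂m)) (G i)] with x h1
        rw [h1, Pi.smul_apply, smul_eq_mul]
      filter_upwards [ae_all_iff.2 this] with x hx
      exact Finset.sum_congr rfl fun i _ => hx i
    rw [← key] at hsum
    filter_upwards [hsum, Lp.coeFn_sub (conj (x : ℂ) • A (mk x).toLp) (X (A (mk x).toLp)),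
      Lp.coeFn_smul (conj (x : ℂ)) (A (mk x).toLp), hX (A (mk x).toLp)] with y h1 h2 h3 h4
    rw [h2, Pi.sub_apply, h3, Pi.smul_apply, h4] at h1
    have := congrArg conj h1
    simp only [map_mul, map_sub, map_sum, Complex.conj_ofReal, smul_eq_mul, Complex.conj_conj]
      at this
    rw [← this]; ring
  · have : (Tinv - 1) φ = T (Tinv φ) := by
      rw [_root_.sub_apply, sub_eq_iff_eq_add]
      simpa [add_comm] using hTT φ
    rw [this]
    filter_upwards [hT (Tinv φ)] with x hx
    rw [hx, ← aux_inner (mk x), ← ContinuousLinearMap.adjoint_inner_left, aux_inner']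

lemma aux_cont {m : Measure ℝ} [IsFiniteMeasure m] [NullSingletonClass m] (k : ℝ → ℝ → ℂ) (C : ℝ)
    (I : Set ℝ) (hk1 : ∀ x, Measurable (fun y => k x y)) (hkb : ∀ x y, ‖k x y‖ ≤ C)
    (hc : ∀ x ∈ I, ∀ y ∈ I, x ≠ y → ContinuousWithinAt (fun x => k x y) I x)
    (hI : ∀ᵐ y ∂m, y ∈ I)
    (w : ℝ → ℂ) (hw : Integrable w m) : ContinuousOn (fun x => ∫ y, k x y * w y ∂m) I := by
  intro x hx
  refine continuousWithinAt_of_dominated (bound := fun y => C * ‖w y‖)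
    (Eventually.of_forall fun x => (hk1 x).aestronglyMeasurable.mul hw.1)
    (Eventually.of_forall fun x => ae_of_all _ fun y => ?_) (hw.norm.const_mul C) ?_
  · rw [norm_mul]
    exact mul_le_mul_of_nonneg_right (hkb x y) (norm_nonneg _)
  · have : ∀ᵐ y ∂m, y ≠ x := by simp [ae_iff]
    filter_upwards [this, hI] with y hy hyI
    exact (hc x hx y hyI hy.symm).mul continuousWithinAt_const

lemma aux_cancel (s x : ℝ) (hx : x ∈ Set.Ioo (-s) s) (g : ℝ → ℂ) (hg : ContinuousAt g x)
    (hi : IntegrableOn (fun y => g y / ((x : ℂ) - (y : ℂ))) (Set.Ioo (-s) s)) : g x = 0 := by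
  by_contra hne
  have hs : -s < s := hx.1.trans hx.2
  have hpos : 0 < ‖g x‖ / 2 := half_pos (norm_pos_iff.2 hne)
  have hev : ∀ᶠ y in 𝓝[≠] x, ‖g x‖ / 2 < ‖g y‖ :=
    (hg.norm.eventually (lt_mem_nhds (half_lt_self (norm_pos_iff.2 hne)))).filter_mono
      nhdsWithin_le_nhds
  have hO : (fun y => (y - x)⁻¹) =O[𝓝[≠] x] (fun y => g y / ((x : ℂ) - (y : ℂ))) := by
    refine Asymptotics.IsBigO.of_bound (‖g x‖ / 2)⁻¹ ?_
    filter_upwards [hev] with y hy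
    have e : ‖(x : ℂ) - (y : ℂ)‖ = |y - x| := by
      rw [← Complex.ofReal_sub, Complex.norm_real, Real.norm_eq_abs, abs_sub_comm]
    rw [norm_div, e, norm_inv, Real.norm_eq_abs, div_eq_mul_inv ‖g y‖, ← mul_assoc]
    refine le_mul_of_one_le_left (by positivity) ?_
    rw [inv_mul_eq_div, one_le_div hpos]
    exact hy.le
  refine not_intervalIntegrable_of_sub_inv_isBigO_punctured hO hs.ne
    (by rw [Set.uIcc_of_le hs.le]; exact Set.Ioo_subset_Icc_self hx) ?_
  rw [intervalIntegrable_iff_integrableOn_Ioo_of_le hs.le]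
  exact hi

lemma aux_bound {M : ℕ} (I : Set ℝ) (hI : IsCompact I) (f : Fin M → ℝ → ℂ)
    (hf : ∀ i, ContinuousOn (f i) I) : ∃ B : ℝ, 0 ≤ B ∧ ∀ i, ∀ x ∈ I, ‖f i x‖ ≤ B := by
  choose b hb using fun i => hI.exists_bound_of_continuousOn (hf i)
  refine ⟨∑ i, |b i|, by positivity, fun i x hx => (hb i x hx).trans ((le_abs_self _).trans ?_)⟩
  exact Finset.single_le_sum (f := fun i => |b i|) (fun _ _ => abs_nonneg _) (Finset.mem_univ i)

lemma aux_main (m : Measure ℝ) [IsFiniteMeasure m] [NullSingletonClass m]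
    (s : ℝ) (hs : 0 < s) (M : ℕ) (hM : 1 ≤ M)
    (f h : Fin M → ℝ → ℂ)
    (U : Set ℝ) (hU : IsOpen U) (hUs : Set.Icc (-s) s ⊆ U)
    (hf : ∀ i, ContDiffOn ℝ (⊤ : ℕ∞) (f i) U) (hh : ∀ i, ContDiffOn ℝ (⊤ : ℕ∞) (h i) U)
    (hcancel : ∀ lam : ℝ, ∑ i, f i lam * h i lam = 0)
    -- the integral operator K on L²((-s,s)) ...
    (T : Lp ℂ 2 m →L[ℂ]
         Lp ℂ 2 m)
    (hT : ∀ φ : Lp ℂ 2 m,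
      (T φ : ℝ → ℂ) =ᵐ[m]
        fun lam => ∫ mu_, intKernel f h lam mu_ * (φ : ℝ → ℂ) mu_ ∂m)
    -- ... such that I - K has a bounded inverse
    (hm : m = volume.restrict (Set.Ioo (-s) s))
    (Tinv : Lp ℂ 2 m →L[ℂ]
            Lp ℂ 2 m)
    (hTinv₁ : (1 - T) * Tinv = 1) (hTinv₂ : Tinv * (1 - T) = 1) :
    ∃ F H : Fin M → ℝ → ℂ,
      (∀ i, ContinuousOn (F i) (Set.Icc (-s) s)) ∧
      (∀ i, ContinuousOn (H i) (Set.Icc (-s) s)) ∧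
      -- Fᵢ = (I-K)⁻¹fᵢ
      (∀ i, ∀ lam ∈ Set.Icc (-s) s,
        F i lam - (∫ mu_, intKernel f h lam mu_ * F i mu_ ∂m) = f i lam) ∧
      -- Hᵢ = (I-Kᵗ)⁻¹hᵢ
      (∀ i, ∀ lam ∈ Set.Icc (-s) s,
        H i lam - (∫ mu_, intKernel f h mu_ lam * H i mu_ ∂m) = h i lam) ∧
      -- the cancellation property of the resolvent kernel
      (∀ lam ∈ Set.Ioo (-s) s, ∑ i, F i lam * H i lam = 0) ∧
      -- (I-K)⁻¹ = I + R with R the integral operator with kernel (∑ᵢ Fᵢ(λ)Hᵢ(μ))/(λ-μ)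
      (∃ Rop : Lp ℂ 2 m →L[ℂ]
               Lp ℂ 2 m,
        (∀ φ : Lp ℂ 2 m,
          (Rop φ : ℝ → ℂ) =ᵐ[m]
            fun lam => ∫ mu_,
              ((∑ i, F i lam * H i mu_) / (((lam:ℝ):ℂ) - ((mu_:ℝ):ℂ))) * (φ : ℝ → ℂ) mu_ ∂m) ∧
        Tinv = 1 + Rop) := by
  classical
  have hI0 : ∃ I, I = Set.Icc (-s) s := ⟨_, rfl⟩
  obtain ⟨I, hI⟩ := hI0
  rw [← hI] at hUs ⊢
  have hIc : IsCompact I := hI ▸ isCompact_Icc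
  have hIm : MeasurableSet I := hI ▸ measurableSet_Icc
  have hmI : ∀ᵐ y ∂m, y ∈ I := by
    rw [hm, hI]
    filter_upwards [ae_restrict_mem measurableSet_Ioo] with y hy
    exact Set.Ioo_subset_Icc_self hy
  have hfI : ∀ i, ContinuousOn (f i) I := fun i => (hf i).continuousOn.mono hUs
  have hhI : ∀ i, ContinuousOn (h i) I := fun i => (hh i).continuousOn.mono hUs
  obtain ⟨B₁, hB₁, hfB⟩ := aux_bound I hIc f hfI
  obtain ⟨B₂, hB₂, hhB⟩ := aux_bound I hIc h hhI
  obtain ⟨L, hL, hdL⟩ := aux_bound I hIc (fun i => deriv (f i)) (fun i =>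
    ((hf i).continuousOn_deriv_of_isOpen hU (by norm_cast)).mono hUs)
  have hlip : ∀ i, ∀ x ∈ I, ∀ y ∈ I, ‖f i x - f i y‖ ≤ L * |x - y| := by
    intro i x hx y hy
    have := (hI ▸ convex_Icc (-s) s : Convex ℝ I).norm_image_sub_le_of_norm_deriv_le (f := f i) (C := L)
      (fun z hz => ((hf i).differentiableOn (by simp)).differentiableAt
        (hU.mem_nhds (hUs hz))) (fun z hz => hdL i z hz) hy hx
    simpa using this
  obtain ⟨f', hf'⟩ : ∃ f' : Fin M → ℝ → ℂ, f' = fun i => I.indicator (f i) := ⟨_, rfl⟩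
  obtain ⟨h', hh'⟩ : ∃ h' : Fin M → ℝ → ℂ, h' = fun i => I.indicator (h i) := ⟨_, rfl⟩
  have ef : ∀ i, ∀ x ∈ I, f' i x = f i x := by rw [hf']; exact fun i x hx => Set.indicator_of_mem hx _
  have eh : ∀ i, ∀ x ∈ I, h' i x = h i x := by rw [hh']; exact fun i x hx => Set.indicator_of_mem hx _
  have nf : ∀ i, ∀ x ∉ I, f' i x = 0 := by rw [hf']; exact fun i x hx => Set.indicator_of_notMem hx _
  have nh : ∀ i, ∀ x ∉ I, h' i x = 0 := by rw [hh']; exact fun i x hx => Set.indicator_of_notMem hx _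
  have mind : ∀ g : ℝ → ℂ, ContinuousOn g I → Measurable (I.indicator g) := by
    intro g hg
    rw [← Set.piecewise_eq_indicator]
    exact hg.measurable_piecewise continuousOn_const hIm
  have hfm : ∀ i, Measurable (f' i) := by rw [hf']; exact fun i => mind _ (hfI i)
  have hhm : ∀ i, Measurable (h' i) := by rw [hh']; exact fun i => mind _ (hhI i)
  have hfb : ∀ i x, ‖f' i x‖ ≤ max B₁ B₂ := by
    intro i x
    by_cases hx : x ∈ I
    · rw [ef i x hx]; exact (hfB i x hx).trans (le_max_left _ _)
    · rw [nf i x hx, norm_zero]; exact hB₁.trans (le_max_left _ _)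
  have hhb : ∀ i x, ‖h' i x‖ ≤ max B₁ B₂ := by
    intro i x
    by_cases hx : x ∈ I
    · rw [eh i x hx]; exact (hhB i x hx).trans (le_max_right _ _)
    · rw [nh i x hx, norm_zero]; exact hB₁.trans (le_max_left _ _)
  obtain ⟨k, hkdef⟩ : ∃ k : ℝ → ℝ → ℂ,
    k = fun x y => (∑ i, f' i x * h' i y) / ((x : ℂ) - (y : ℂ)) := ⟨_, rfl⟩
  have hkm : Measurable (Function.uncurry k) := by
    rw [hkdef]
    refine Measurable.div (Finset.measurable_sum _ fun i _ =>
      ((hfm i).comp measurable_fst).mul ((hhm i).comp measurable_snd)) ?_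
    fun_prop
  have hk1 : ∀ x, Measurable (fun y => k x y) := fun x => hkm.comp measurable_prodMk_left
  have hk2 : ∀ y, Measurable (fun x => k x y) := fun y => hkm.comp measurable_prodMk_right
  have hk : ∀ x y : ℝ, ((x : ℂ) - (y : ℂ)) * k x y = ∑ i, f' i x * h' i y := by
    intro x y
    by_cases hxy : x = y
    · subst hxy
      rw [sub_self, zero_mul]
      by_cases hx : x ∈ I
      · rw [← hcancel x]
        exact Finset.sum_congr rfl fun i _ => by rw [ef i x hx, eh i x hx]
      · symm
        exact Finset.sum_eq_zero fun i _ => by rw [nf i x hx, zero_mul]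
    · simp only [hkdef]
      refine mul_div_cancel₀ _ ?_
      rw [← Complex.ofReal_sub]
      exact_mod_cast sub_ne_zero.2 hxy
  have hkb : ∀ x y, ‖k x y‖ ≤ ∑ _i : Fin M, L * B₂ := by
    intro x y
    have hC : (0 : ℝ) ≤ ∑ _i : Fin M, L * B₂ := Finset.sum_nonneg fun _ _ => by positivity
    by_cases hx : x ∈ I
    · by_cases hy : y ∈ I
      · have e : ‖(x : ℂ) - (y : ℂ)‖ = |x - y| := by
          rw [← Complex.ofReal_sub, Complex.norm_real, Real.norm_eq_abs]
        have : ∑ i, f' i x * h' i y = ∑ i, (f i x - f i y) * h i y := by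
          simp only [sub_mul, Finset.sum_sub_distrib, hcancel y, sub_zero]
          exact Finset.sum_congr rfl fun i _ => by rw [ef i x hx, eh i y hy]
        simp only [hkdef]
        rw [this, norm_div, e]
        refine div_le_of_le_mul₀ (abs_nonneg _) hC ?_
        rw [Finset.sum_mul]
        refine (norm_sum_le _ _).trans (Finset.sum_le_sum fun i _ => ?_)
        rw [norm_mul]
        calc _ ≤ (L * |x - y|) * B₂ := mul_le_mul (hlip i x hx y hy) (hhB i y hy)
              (norm_nonneg _) (by positivity)
          _ = _ := by ring
      · have : k x y = 0 := by simp [hkdef, nh _ y hy]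
        rw [this, norm_zero]; exact hC
    · have : k x y = 0 := by simp [hkdef, nf _ x hx]
      rw [this, norm_zero]; exact hC
  have hneq : ∀ x : ℝ, ∀ᵐ y ∂m, y ≠ x := fun x => by simp [ae_iff]
  have hker : ∀ x ∈ I, ∀ y ∈ I, y ≠ x → intKernel f h x y = k x y := by
    intro x hx y hy hxy
    rw [intKernel, if_neg hxy.symm]
    simp only [hkdef]
    congr 1
    exact Finset.sum_congr rfl fun i _ => by rw [ef i x hx, eh i y hy]
  have hK1 : ∀ x ∈ I, ∀ w w' : ℝ → ℂ, w =ᵐ[m] w' →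
      ∫ y, intKernel f h x y * w y ∂m = ∫ y, k x y * w' y ∂m := by
    intro x hx w w' hw
    refine integral_congr_ae ?_
    filter_upwards [hw, hneq x, hmI] with y h1 h2 h3
    rw [h1, hker x hx y h3 h2]
  have hK2 : ∀ x ∈ I, ∀ w w' : ℝ → ℂ, w =ᵐ[m] w' →
      ∫ y, intKernel f h y x * w y ∂m = ∫ y, k y x * w' y ∂m := by
    intro x hx w w' hw
    refine integral_congr_ae ?_
    filter_upwards [hw, hneq x, hmI] with y h1 h2 h3
    rw [h1, hker y h3 x hx h2.symm]
  have hT' : ∀ φ : Lp ℂ 2 m, (T φ : ℝ → ℂ) =ᵐ[m] fun x => ∫ y, k x y * φ y ∂m := by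
    intro φ
    filter_upwards [hT φ, hmI] with x h1 h2
    rw [h1]
    exact hK1 x h2 _ _ EventuallyEq.rfl
  have hS : ∀ᵐ x ∂m, |x| ≤ s := by
    filter_upwards [hmI] with x hx
    rw [hI] at hx
    exact abs_le.2 hx
  obtain ⟨u, v, r, mu, mv, mr, hu, hv, hr, hR⟩ := aux_core f' h' (max B₁ B₂) _ s hfm hhm hfb hhb
    k hkm hkb hk hS T Tinv hT' hTinv₁ hTinv₂
  have iu : ∀ i, Integrable (u i) m := fun i => (mu i).integrable (by norm_num)
  have iv : ∀ i, Integrable (v i) m := fun i => (mv i).integrable (by norm_num)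
  have hne0 : ∀ x y : ℝ, x ≠ y → (x : ℂ) - (y : ℂ) ≠ 0 := by
    intro x y hxy
    rw [sub_ne_zero]; exact_mod_cast hxy
  have cf' : ∀ i, ContinuousOn (f' i) I := fun i => (hfI i).congr (ef i)
  have ch' : ∀ i, ContinuousOn (h' i) I := fun i => (hhI i).congr (eh i)
  have hc1 : ∀ x ∈ I, ∀ y ∈ I, x ≠ y → ContinuousWithinAt (fun x => k x y) I x := by
    intro x hx y hy hxy
    simp only [hkdef]
    refine ContinuousWithinAt.div (tendsto_finsetSum _ fun i _ =>
      (cf' i x hx).mul continuousWithinAt_const) ?_ (hne0 x y hxy)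
    exact Continuous.continuousWithinAt (by fun_prop)
  have hc2 : ∀ x ∈ I, ∀ y ∈ I, x ≠ y → ContinuousWithinAt (fun x => k y x) I x := by
    intro x hx y hy hxy
    simp only [hkdef]
    refine ContinuousWithinAt.div (tendsto_finsetSum _ fun i _ =>
      continuousWithinAt_const.mul (ch' i x hx)) ?_ (hne0 y x hxy.symm)
    exact Continuous.continuousWithinAt (by fun_prop)
  obtain ⟨F, hF⟩ : ∃ F : Fin M → ℝ → ℂ, F = fun i x => f' i x + ∫ y, k x y * u i y ∂m := ⟨_, rfl⟩
  obtain ⟨H, hH⟩ : ∃ H : Fin M → ℝ → ℂ, H = fun i y => h' i y + ∫ x, k x y * v i x ∂m := ⟨_, rfl⟩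
  have hFu : ∀ i, F i =ᵐ[m] u i := by rw [hF]; exact fun i => (hu i).symm
  have hHv : ∀ i, H i =ᵐ[m] v i := by rw [hH]; exact fun i => (hv i).symm
  have cF : ∀ i, ContinuousOn (F i) I := by
    rw [hF]
    exact fun i => (cf' i).add (aux_cont k _ I hk1 hkb hc1 hmI (u i) (iu i))
  have cH : ∀ i, ContinuousOn (H i) I := by
    rw [hH]
    exact fun i => (ch' i).add (aux_cont (fun x y => k y x) _ I hk2 (fun x y => hkb y x) hc2 hmI (v i) (iv i))
  have hrq : ∀ x : ℝ, r x =ᵐ[m] fun y => (∑ i, F i x * H i y) / ((x : ℂ) - (y : ℂ)) := by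
    intro x
    filter_upwards [hr x, hneq x, ae_all_iff.2 hHv] with y h1 h2 h3
    rw [eq_div_iff (hne0 x y h2.symm), mul_comm, h1]
    exact Finset.sum_congr rfl fun i _ => by rw [h3 i, hF]
  refine ⟨F, H, cF, cH, fun i x hx => ?_, fun i x hx => ?_, fun x hx => ?_,
    Tinv - 1, fun φ => ?_, by abel⟩
  · rw [hK1 x hx _ _ (hFu i)]
    simp only [hF]
    rw [add_sub_cancel_right, ef i x hx]
  · rw [hK2 x hx _ _ (hHv i)]
    simp only [hH]
    rw [add_sub_cancel_right, eh i x hx]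
  · refine aux_cancel s x hx (fun y => ∑ i, F i x * H i y) ?_ ?_
    · have hn : I ∈ 𝓝 x := hI ▸ Icc_mem_nhds hx.1 hx.2
      exact tendsto_finsetSum _ fun i _ =>
        continuousAt_const.mul ((cH i).continuousAt hn)
    · rw [IntegrableOn, ← hm]
      exact ((mr x).integrable (by norm_num)).congr (hrq x)
  · filter_upwards [hR φ] with x hx
    rw [hx]
    refine integral_congr_ae ?_
    filter_upwards [hrq x] with y hy
    rw [hy]

/-- The resolvent of an integrable operator is integrable (Lemma 1): if `I－K` is invertible
then `(I-K)⁻¹ = I + R` where `R` has the integrable kernel `(∑ᵢ Fᵢ(λ)Hᵢ(μ))/(λ-μ)` built from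
`Fᵢ = (I-K)⁻¹fᵢ` and `Hᵢ = (I-Kᵗ)⁻¹hᵢ`, and `∑ᵢ FᵢHᵢ = 0`. -/
theorem resolvent_of_integrable_operator (s : ℝ) (hs : 0 < s) (M : ℕ) (hM : 1 ≤ M)
    (f h : Fin M → ℝ → ℂ)
    (U : Set ℝ) (hU : IsOpen U) (hUs : Set.Icc (-s) s ⊆ U)
    (hf : ∀ i, ContDiffOn ℝ (⊤ : ℕ∞) (f i) U) (hh : ∀ i, ContDiffOn ℝ (⊤ : ℕ∞) (h i) U)
    (hcancel : ∀ lam : ℝ, ∑ i, f i lam * h i lam = 0)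
    -- the integral operator K on L²((-s,s)) ...
    (T : Lp ℂ 2 (volume.restrict (Set.Ioo (-s) s)) →L[ℂ]
         Lp ℂ 2 (volume.restrict (Set.Ioo (-s) s)))
    (hT : ∀ φ : Lp ℂ 2 (volume.restrict (Set.Ioo (-s) s)),
      (T φ : ℝ → ℂ) =ᵐ[volume.restrict (Set.Ioo (-s) s)]
        fun lam => ∫ mu_ in Set.Ioo (-s) s, intKernel f h lam mu_ * (φ : ℝ → ℂ) mu_)
    -- ... such that I - K has a bounded inverse
    (Tinv : Lp ℂ 2 (volume.restrict (Set.Ioo (-s) s)) →L[ℂ]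
            Lp ℂ 2 (volume.restrict (Set.Ioo (-s) s)))
    (hTinv₁ : (1 - T) * Tinv = 1) (hTinv₂ : Tinv * (1 - T) = 1) :
    ∃ F H : Fin M → ℝ → ℂ,
      (∀ i, ContinuousOn (F i) (Set.Icc (-s) s)) ∧
      (∀ i, ContinuousOn (H i) (Set.Icc (-s) s)) ∧
      -- Fᵢ = (I-K)⁻¹fᵢ
      (∀ i, ∀ lam ∈ Set.Icc (-s) s,
        F i lam - (∫ mu_ in Set.Ioo (-s) s, intKernel f h lam mu_ * F i mu_) = f i lam) ∧
      -- Hᵢ = (I-Kᵗ)⁻¹hᵢ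
      (∀ i, ∀ lam ∈ Set.Icc (-s) s,
        H i lam - (∫ mu_ in Set.Ioo (-s) s, intKernel f h mu_ lam * H i mu_) = h i lam) ∧
      -- the cancellation property of the resolvent kernel
      (∀ lam ∈ Set.Ioo (-s) s, ∑ i, F i lam * H i lam = 0) ∧
      -- (I-K)⁻¹ = I + R with R the integral operator with kernel (∑ᵢ Fᵢ(λ)Hᵢ(μ))/(λ-μ)
      (∃ Rop : Lp ℂ 2 (volume.restrict (Set.Ioo (-s) s)) →L[ℂ]
               Lp ℂ 2 (volume.restrict (Set.Ioo (-s) s)),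
        (∀ φ : Lp ℂ 2 (volume.restrict (Set.Ioo (-s) s)),
          (Rop φ : ℝ → ℂ) =ᵐ[volume.restrict (Set.Ioo (-s) s)]
            fun lam => ∫ mu_ in Set.Ioo (-s) s,
              ((∑ i, F i lam * H i mu_) / (((lam:ℝ):ℂ) - ((mu_:ℝ):ℂ))) * (φ : ℝ → ℂ) mu_) ∧
        Tinv = 1 + Rop) := by
  exact aux_main (volume.restrict (Set.Ioo (-s) s)) s hs M hM f h U hU hUs hf hh hcancel T hT rfl
    Tinv hTinv₁ hTinv₂

end
end

section
/- Let $s>0$, $M\ge1$, and let $f_1,\dots,f_M,h_1,\dots,h_M:\mathbb{R}\to\mathbb{C}$ be smooth on a neighborhood of $[-s,s]$ with $\sum_{i=1}^M f_i(\lambda)h_i(\lambda)=0$ for all $\lambda$, let $K$ be the integral operator on $L^2((-s,s))$ with kernel $K(\lambda,\mu)=\frac{\sum_i f_i(\lambda)h_i(\mu)}{\lambda-\mu}$, assume $I-K$ has a bounded inverse, and set $F:=(I-K)^{-1}f$ (entrywise, $f=(f_1,\dots,f_M)^t$, $h=(h_1,\dots,h_M)^t$). Define $Y(z):= I - \int_{-s}^{s}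 F(w)h(w)^t\,\frac{dw}{w-z}$ for $z\in\mathbb{C}\setminus[-s,s]$. Then for every $\lambda\in(-s,s)$ the boundary values $Y_{\pm}(\lambda):=\lim_{\varepsilon\downarrow 0}Y(\lambda\pm i\varepsilon)$ exist, they satisfy the jump relation $Y_+(\lambda)=Y_-(\lambda)\bigl(I-2\pi i\, f(\lambda)h(\lambda)^t\bigr)$, and $Y_+(\lambda)f(\lambda)=Y_-(\lambda)f(\lambda)=F(\lambda)$. -/
noncomputable section
open MeasureTheory Filter Topology

/-- The Cauchy-integral matrix `Y(z) = I - ∫_{-s}^{s} F(w)h(w)ᵗ dw/(w-z)`. -/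
def Ymat (s : ℝ) {M : ℕ} (F h : Fin M → ℝ → ℂ) (z : ℂ) : Matrix (Fin M) (Fin M) ℂ :=
  1 - Matrix.of fun i j => ∫ w in Set.Ioo (-s) s, F i w * h j w / (((w:ℝ):ℂ) - z)

theorem aux_lip {s : ℝ} {U : Set ℝ} (hU : IsOpen U) (hUs : Set.Icc (-s) s ⊆ U) {f : ℝ → ℂ}
    (hf : ContDiffOn ℝ (⊤ : ℕ∞) f U) :
    ∃ L : ℝ, ∀ x ∈ Set.Icc (-s) s, ∀ y ∈ Set.Icc (-s) s, ‖f x - f y‖ ≤ L * |x - y| := by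
  have hd : ContinuousOn (deriv f) (Set.Icc (-s) s) :=
    (hf.continuousOn_deriv_of_isOpen hU (by norm_num)).mono hUs
  obtain ⟨L, hL⟩ := isCompact_Icc.exists_bound_of_continuousOn hd
  refine ⟨L, fun x hx y hy => ?_⟩
  have := (convex_Icc (-s) s).norm_image_sub_le_of_norm_deriv_le (f := f) (C := L)
    (fun z hz => ((hf.contDiffAt (hU.mem_nhds (hUs hz))).differentiableAt (by norm_num)))
    hL hy hx
  simpa using this

theorem aux_mem {s a b t : ℝ} (ha : a ∈ Set.Icc (-s) s) (hb : b ∈ Set.Icc (-s) s)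
    (ht : t ∈ Set.Icc (0:ℝ) 1) : a + t * (b - a) ∈ Set.Icc (-s) s := by
  obtain ⟨h1, h2⟩ := ha
  obtain ⟨h3, h4⟩ := hb
  obtain ⟨h5, h6⟩ := ht
  constructor <;> nlinarith

theorem aux_dcont {s : ℝ} {U : Set ℝ} (hU : IsOpen U) (hUs : Set.Icc (-s) s ⊆ U) {f : ℝ → ℂ}
    (hf : ContDiffOn ℝ (⊤ : ℕ∞) f U) {a b : ℝ} (ha : a ∈ Set.Icc (-s) s)
    (hb : b ∈ Set.Icc (-s) s) :
    ContinuousOn (fun t : ℝ => deriv f (a + t * (b - a))) (Set.Icc 0 1) := by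
  have hd : ContinuousOn (deriv f) (Set.Icc (-s) s) :=
    (hf.continuousOn_deriv_of_isOpen hU (by norm_num)).mono hUs
  exact hd.comp (by fun_prop) (fun t ht => aux_mem ha hb ht)

theorem aux_dslope {s : ℝ} {U : Set ℝ} (hU : IsOpen U) (hUs : Set.Icc (-s) s ⊆ U) {f : ℝ → ℂ}
    (hf : ContDiffOn ℝ (⊤ : ℕ∞) f U) {a b : ℝ} (ha : a ∈ Set.Icc (-s) s)
    (hb : b ∈ Set.Icc (-s) s) :
    dslope f a b = ∫ t in (0:ℝ)..1, deriv f (a + t * (b - a)) := by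
  have hc := aux_dcont hU hUs hf ha hb
  by_cases hab : b = a
  · subst hab
    simp
  · rw [dslope_of_ne _ hab, slope_def_module]
    have h1 : ∫ t in (0:ℝ)..1, (b - a) • deriv f (a + t * (b - a)) =
        f (a + 1 * (b - a)) - f (a + 0 * (b - a)) := by
      apply intervalIntegral.integral_eq_sub_of_hasDerivAt
        (f := fun t : ℝ => f (a + t * (b - a)))
      · intro t ht
        rw [Set.uIcc_of_le zero_le_one] at ht
        have hd : HasDerivAt f (deriv f (a + t * (b - a))) (a + t * (b - a)) :=
          ((hf.contDiffAt (hU.mem_nhds (hUs (aux_mem ha hb ht)))).differentiableAt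
            (by norm_num)).hasDerivAt
        have hi : HasDerivAt (fun t : ℝ => a + t * (b - a)) (b - a) t := by
          simpa using ((hasDerivAt_id t).mul_const (b - a)).const_add a
        exact hd.scomp t hi
      · apply ContinuousOn.intervalIntegrable
        rw [Set.uIcc_of_le zero_le_one]
        exact hc.const_smul (b - a)
    rw [intervalIntegral.integral_smul] at h1
    have h2 : b - a ≠ 0 := sub_ne_zero.2 hab
    have h3 : f b - f a = (b - a) • ∫ t in (0:ℝ)..1, deriv f (a + t * (b - a)) := by
      rw [h1]; simp
    rw [h3, smul_smul, inv_mul_cancel₀ h2, one_smul]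

theorem aux_dslope_lip {s : ℝ} {U : Set ℝ} (hU : IsOpen U) (hUs : Set.Icc (-s) s ⊆ U)
    {f : ℝ → ℂ} (hf : ContDiffOn ℝ (⊤ : ℕ∞) f U) :
    ∃ L : ℝ, ∀ m ∈ Set.Icc (-s) s, ∀ x ∈ Set.Icc (-s) s, ∀ y ∈ Set.Icc (-s) s,
      ‖dslope f x m - dslope f y m‖ ≤ L * |x - y| := by
  have hd : ContDiffOn ℝ (⊤ : ℕ∞) (deriv f) U := hf.deriv_of_isOpen hU (by simp)
  obtain ⟨L, hL⟩ := aux_lip hU hUs hd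
  have hi : ∀ a ∈ Set.Icc (-s) s, ∀ b ∈ Set.Icc (-s) s,
      IntervalIntegrable (fun t : ℝ => deriv f (a + t * (b - a))) volume 0 1 := by
    intro a ha b hb
    apply ContinuousOn.intervalIntegrable
    rw [Set.uIcc_of_le zero_le_one]
    exact aux_dcont hU hUs hf ha hb
  refine ⟨L, fun m hm x hx y hy => ?_⟩
  rw [aux_dslope hU hUs hf hx hm, aux_dslope hU hUs hf hy hm,
    ← intervalIntegral.integral_sub (hi x hx m hm) (hi y hy m hm)]
  have := intervalIntegral.norm_integral_le_of_norm_le_const (a := (0:ℝ)) (b := 1)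
    (C := L * |x - y|)
    (f := fun t => deriv f (x + t * (m - x)) - deriv f (y + t * (m - y))) (by
      intro t ht
      rw [Set.uIoc_of_le zero_le_one] at ht
      have ht' : t ∈ Set.Icc (0:ℝ) 1 := ⟨ht.1.le, ht.2⟩
      have hb := hL _ (aux_mem hx hm ht') _ (aux_mem hy hm ht')
      have e : x + t * (m - x) - (y + t * (m - y)) = (1 - t) * (x - y) := by ring
      rw [e, abs_mul, abs_of_nonneg (by linarith [ht.2] : (0:ℝ) ≤ 1 - t)] at hb
      have hn : 0 ≤ L * |x - y| := (norm_nonneg _).trans (hL x hx y hy)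
      nlinarith [ht.1])
  simpa using this

theorem aux_kernel {M : ℕ} (f h : Fin M → ℝ → ℂ)
    (hcancel : ∀ lam : ℝ, ∑ i, f i lam * h i lam = 0) (x m : ℝ) :
    intKernel f h x m = ∑ i, dslope (f i) x m * h i m := by
  unfold intKernel
  split_ifs with hx
  · subst hx; simp
  · have hc : ((x:ℝ):ℂ) - ((m:ℝ):ℂ) ≠ 0 := by
      rw [← Complex.ofReal_sub]; exact_mod_cast sub_ne_zero.2 hx
    have hc' : ((m:ℝ):ℂ) - ((x:ℝ):ℂ) ≠ 0 := by
      rw [← neg_sub]; exact neg_ne_zero.2 hc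
    have e : ∀ i, dslope (f i) x m * h i m =
        (f i m * h i m - f i x * h i m) / (((m:ℝ):ℂ) - ((x:ℝ):ℂ)) := by
      intro i
      rw [dslope_of_ne _ (Ne.symm hx), slope_def_module, Complex.real_smul]
      push_cast
      field_simp
    rw [Finset.sum_congr rfl (fun i _ => e i), ← Finset.sum_div, Finset.sum_sub_distrib,
      hcancel m]
    rw [div_eq_div_iff hc hc']
    ring

theorem aux_dslope_cont {s : ℝ} {U : Set ℝ} (hU : IsOpen U) (hUs : Set.Icc (-s) s ⊆ U)
    {f : ℝ → ℂ} (hf : ContDiffOn ℝ (⊤ : ℕ∞) f U) {x : ℝ} (hx : x ∈ Set.Icc (-s) s) :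
    ContinuousOn (dslope f x) (Set.Icc (-s) s) := by
  have hxU := hU.mem_nhds (hUs hx)
  exact ((continuousOn_dslope hxU).2 ⟨hf.continuousOn,
    (hf.contDiffAt hxU).differentiableAt (by norm_num)⟩).mono hUs

theorem aux_F_lip {s : ℝ} (hs : 0 < s) {M : ℕ}
    {f h : Fin M → ℝ → ℂ}
    {U : Set ℝ} (hU : IsOpen U) (hUs : Set.Icc (-s) s ⊆ U)
    (hf : ∀ i, ContDiffOn ℝ (⊤ : ℕ∞) (f i) U) (hh : ∀ i, ContDiffOn ℝ (⊤ : ℕ∞) (h i) U)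
    (hcancel : ∀ lam : ℝ, ∑ i, f i lam * h i lam = 0)
    {f0 F : ℝ → ℂ} (hf0 : ContDiffOn ℝ (⊤ : ℕ∞) f0 U)
    (hFcont : ContinuousOn F (Set.Icc (-s) s))
    (hFeq : ∀ lam ∈ Set.Icc (-s) s,
      F lam - (∫ mu_ in Set.Ioo (-s) s, intKernel f h lam mu_ * F mu_) = f0 lam) :
    ∃ L : ℝ, ∀ x ∈ Set.Icc (-s) s, ∀ y ∈ Set.Icc (-s) s, ‖F x - F y‖ ≤ L * |x - y| := by
  obtain ⟨L0, hL0⟩ := aux_lip hU hUs hf0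
  choose L hL using fun i => aux_dslope_lip hU hUs (hf i)
  have hhc : ∀ i, ContinuousOn (h i) (Set.Icc (-s) s) := fun i => (hh i).continuousOn.mono hUs
  choose H hH using fun i => isCompact_Icc.exists_bound_of_continuousOn (hhc i)
  obtain ⟨B, hB⟩ := isCompact_Icc.exists_bound_of_continuousOn hFcont
  have hint : ∀ x ∈ Set.Icc (-s) s,
      IntegrableOn (fun m => intKernel f h x m * F m) (Set.Ioo (-s) s) := by
    intro x hx
    have : ContinuousOn (fun m => intKernel f h x m * F m) (Set.Icc (-s) s) := by
      simp_rw [aux_kernel f h hcancel]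
      exact (continuousOn_finsetSum _
        fun i _ => (aux_dslope_cont hU hUs (hf i) hx).mul (hhc i)).mul hFcont
    exact (this.integrableOn_compact isCompact_Icc).mono_set Set.Ioo_subset_Icc_self
  refine ⟨L0 + (∑ i, L i * H i) * B * (2 * s), fun x hx y hy => ?_⟩
  have e : F x - F y = (f0 x - f0 y) + ∫ m in Set.Ioo (-s) s,
      (intKernel f h x m * F m - intKernel f h y m * F m) := by
    rw [integral_sub (hint x hx) (hint y hy), ← hFeq x hx, ← hFeq y hy]
    ring
  have hb : ‖∫ m in Set.Ioo (-s) s, (intKernel f h x m * F m - intKernel f h y m * F m)‖ ≤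
      ((∑ i, (L i * |x - y|) * H i) * B) * (volume.real (Set.Ioo (-s) s)) := by
    apply norm_setIntegral_le_of_norm_le_const
    · simp
    · intro m hm
      have hm' := Set.Ioo_subset_Icc_self hm
      rw [← sub_mul, norm_mul, aux_kernel f h hcancel, aux_kernel f h hcancel,
        ← Finset.sum_sub_distrib]
      have h1 : ‖∑ i, (dslope (f i) x m * h i m - dslope (f i) y m * h i m)‖ ≤
          ∑ i, (L i * |x - y|) * H i := by
        refine norm_sum_le_of_le _ fun i _ => ?_
        rw [← sub_mul, norm_mul]
        have := hL i m hm' x hx y hy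
        exact mul_le_mul this (hH i m hm') (norm_nonneg _) ((norm_nonneg _).trans this)
      exact mul_le_mul h1 (hB m hm') (norm_nonneg _) ((norm_nonneg _).trans h1)
  rw [e]
  refine (norm_add_le _ _).trans ?_
  have hv : volume.real (Set.Ioo (-s) s) = 2 * s := by
    rw [Real.volume_real_Ioo_of_le (by linarith)]; ring
  rw [hv] at hb
  have := hL0 x hx y hy
  have e2 : ∑ i, (L i * |x - y|) * H i = (∑ i, L i * H i) * |x - y| := by
    rw [Finset.sum_mul]; exact Finset.sum_congr rfl fun i _ => by ring
  rw [e2] at hb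
  calc _ ≤ _ := add_le_add this hb
    _ = _ := by ring

theorem aux_norm_ge (w lam e : ℝ) : |w - lam| ≤ ‖(w:ℂ) - ((lam:ℂ) + (e:ℂ) * Complex.I)‖ := by
  have := Complex.abs_re_le_norm ((w:ℂ) - ((lam:ℂ) + (e:ℂ) * Complex.I))
  simpa using this

theorem aux_dct {s lam C : ℝ} {k : ℝ → ℂ} (hk : ContinuousOn k (Set.Icc (-s) s))
    (hC : ∀ w ∈ Set.Icc (-s) s, ‖k w‖ ≤ C * |w - lam|) :
    Tendsto (fun e : ℝ => ∫ w in Set.Ioo (-s) s, k w / ((w:ℂ) - ((lam:ℂ) + (e:ℂ) * Complex.I)))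
      (𝓝 0) (𝓝 (∫ w in Set.Ioo (-s) s, k w / ((w:ℂ) - (lam:ℂ)))) := by
  have hkm : AEStronglyMeasurable k (volume.restrict (Set.Ioo (-s) s)) :=
    (hk.mono Set.Ioo_subset_Icc_self).aestronglyMeasurable measurableSet_Ioo
  apply tendsto_integral_filter_of_dominated_convergence (fun _ => |C|)
  · refine Eventually.of_forall fun e => ?_
    refine AEStronglyMeasurable.div₀ ?_ ?_ 
    · exact hkm
    · exact (by fun_prop : Continuous fun w : ℝ => (w:ℂ) - ((lam:ℂ) + (e:ℂ) * Complex.I)).aestronglyMeasurable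
  · refine Eventually.of_forall fun e => ?_
    refine (ae_restrict_iff' measurableSet_Ioo).2 (Eventually.of_forall fun w hw => ?_)
    rw [norm_div]
    apply div_le_of_le_mul₀ (norm_nonneg _) (abs_nonneg _)
    refine (hC w (Set.Ioo_subset_Icc_self hw)).trans ?_
    exact mul_le_mul (le_abs_self _) (aux_norm_ge w lam e) (abs_nonneg _) (abs_nonneg _)
  · exact integrable_const _
  · refine ae_restrict_of_ae ?_
    have : ∀ᵐ w : ℝ, w ≠ lam := by simp [ae_iff]
    filter_upwards [this] with w hw
    have hne : (w:ℂ) - ((lam:ℂ) + ((0:ℝ):ℂ) * Complex.I) ≠ 0 := by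
      simp only [Complex.ofReal_zero, zero_mul, add_zero]
      rw [← Complex.ofReal_sub]; exact_mod_cast sub_ne_zero.2 hw
    have : ContinuousAt (fun e : ℝ => k w / ((w:ℂ) - ((lam:ℂ) + (e:ℂ) * Complex.I))) 0 := by
      refine ContinuousAt.div continuousAt_const ?_ hne
      fun_prop
    simpa [ContinuousAt] using this

theorem aux_log {s lam e : ℝ} (hs : 0 < s) (he : e ≠ 0) :
    IntegrableOn (fun w : ℝ => 1 / ((w:ℂ) - ((lam:ℂ) + (e:ℂ) * Complex.I))) (Set.Ioo (-s) s) ∧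
    ∫ w in Set.Ioo (-s) s, 1 / ((w:ℂ) - ((lam:ℂ) + (e:ℂ) * Complex.I)) =
      Complex.log ((s:ℂ) - ((lam:ℂ) + (e:ℂ) * Complex.I)) -
      Complex.log (((-s:ℝ):ℂ) - ((lam:ℂ) + (e:ℂ) * Complex.I)) := by
  have hsl : ∀ w : ℝ, (w:ℂ) - ((lam:ℂ) + (e:ℂ) * Complex.I) ∈ Complex.slitPlane := by
    intro w
    rw [Complex.mem_slitPlane_iff]
    right
    simpa using he
  have hc : Continuous (fun w : ℝ => 1 / ((w:ℂ) - ((lam:ℂ) + (e:ℂ) * Complex.I))) :=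
    continuous_const.div (by fun_prop) (fun w => Complex.slitPlane_ne_zero (hsl w))
  refine ⟨(hc.continuousOn.integrableOn_compact isCompact_Icc).mono_set
    Set.Ioo_subset_Icc_self, ?_⟩
  rw [← integral_Ioc_eq_integral_Ioo, ← intervalIntegral.integral_of_le (by linarith)]
  apply intervalIntegral.integral_eq_sub_of_hasDerivAt
    (f := fun w : ℝ => Complex.log ((w:ℂ) - ((lam:ℂ) + (e:ℂ) * Complex.I)))
  · intro w _
    have hi : HasDerivAt (fun w : ℝ => (w:ℂ) - ((lam:ℂ) + (e:ℂ) * Complex.I)) 1 w :=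
      (Complex.ofRealCLM.hasDerivAt (x := w)).sub_const _
    exact hi.clog_real (hsl w)
  · exact hc.intervalIntegrable _ _

theorem aux_log_lim {s lam : ℝ} (hs : 0 < s) (hl : lam ∈ Set.Ioo (-s) s) :
    ∃ c : ℂ, Tendsto (fun e : ℝ => ∫ w in Set.Ioo (-s) s,
        1 / ((w:ℂ) - ((lam:ℂ) + (e:ℂ) * Complex.I))) (𝓝[>] 0) (𝓝 (c + Real.pi * Complex.I)) ∧
      Tendsto (fun e : ℝ => ∫ w in Set.Ioo (-s) s,
        1 / ((w:ℂ) - ((lam:ℂ) + (e:ℂ) * Complex.I))) (𝓝[<] 0) (𝓝 (c - Real.pi * Complex.I)) := by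
  have h1 : Tendsto (fun e : ℝ => Complex.log ((s:ℂ) - ((lam:ℂ) + (e:ℂ) * Complex.I))) (𝓝 0)
      (𝓝 (Complex.log ((s:ℂ) - (lam:ℂ)))) := by
    have : ContinuousAt (fun e : ℝ => Complex.log ((s:ℂ) - ((lam:ℂ) + (e:ℂ) * Complex.I))) 0 := by
      refine ContinuousAt.clog (by fun_prop) ?_
      rw [Complex.mem_slitPlane_iff]
      left
      simpa using hl.2
    simpa [ContinuousAt] using this
  have hre : (((-s:ℝ):ℂ) - (lam:ℂ)).re < 0 := by simp; linarith [hl.1]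
  have him : (((-s:ℝ):ℂ) - (lam:ℂ)).im = 0 := by simp
  have hbase : Tendsto (fun e : ℝ => ((-s:ℝ):ℂ) - ((lam:ℂ) + (e:ℂ) * Complex.I)) (𝓝 0)
      (𝓝 (((-s:ℝ):ℂ) - (lam:ℂ))) := by
    have : Continuous (fun e : ℝ => ((-s:ℝ):ℂ) - ((lam:ℂ) + (e:ℂ) * Complex.I)) := by fun_prop
    simpa using this.tendsto 0
  have h2 := (Complex.tendsto_log_nhdsWithin_im_neg_of_re_neg_of_im_zero hre him).comp
    (tendsto_nhdsWithin_iff.2 ⟨hbase.mono_left (nhdsWithin_le_nhds (s := Set.Ioi 0)), by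
      filter_upwards [self_mem_nhdsWithin] with e he
      simpa using he⟩)
  have h3 := (Complex.tendsto_log_nhdsWithin_im_nonneg_of_re_neg_of_im_zero hre him).comp
    (tendsto_nhdsWithin_iff.2 ⟨hbase.mono_left (nhdsWithin_le_nhds (s := Set.Iio 0)), by
      filter_upwards [self_mem_nhdsWithin] with e he
      simpa using le_of_lt he⟩)
  refine ⟨Complex.log ((s:ℂ) - (lam:ℂ)) - Real.log ‖(((-s:ℝ):ℂ) - (lam:ℂ))‖, ?_, ?_⟩
  · have := (h1.mono_left (nhdsWithin_le_nhds (s := Set.Ioi 0))).sub h2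
    refine Tendsto.congr' ?_ (this.trans (le_of_eq (by congr 1; ring)))
    filter_upwards [self_mem_nhdsWithin] with e he
    exact (aux_log hs (ne_of_gt he)).2.symm
  · have := (h1.mono_left (nhdsWithin_le_nhds (s := Set.Iio 0))).sub h3
    refine Tendsto.congr' ?_ (this.trans (le_of_eq (by congr 1; ring)))
    filter_upwards [self_mem_nhdsWithin] with e he
    exact (aux_log hs (ne_of_lt he)).2.symm

theorem aux_split {s lam C e : ℝ} {g : ℝ → ℂ} (hs : 0 < s) 
    (hg : ContinuousOn g (Set.Icc (-s) s)) (he : e ≠ 0) :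
    ∫ w in Set.Ioo (-s) s, g w / ((w:ℂ) - ((lam:ℂ) + (e:ℂ) * Complex.I)) =
     (∫ w in Set.Ioo (-s) s, (g w - g lam) / ((w:ℂ) - ((lam:ℂ) + (e:ℂ) * Complex.I))) +
     g lam * ∫ w in Set.Ioo (-s) s, 1 / ((w:ℂ) - ((lam:ℂ) + (e:ℂ) * Complex.I)) := by
  rw [← integral_const_mul, ← integral_add]
  · congr 1; ext w; ring
  · have hsl : ∀ w : ℝ, (w:ℂ) - ((lam:ℂ) + (e:ℂ) * Complex.I) ≠ 0 := by
      intro w h0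
      have := congrArg Complex.im h0
      simp at this
      exact he this
    have : ContinuousOn (fun w : ℝ => (g w - g lam) / ((w:ℂ) - ((lam:ℂ) + (e:ℂ) * Complex.I)))
      (Set.Icc (-s) s) := (hg.sub continuousOn_const).div (by fun_prop) (fun w _ => hsl w)
    exact (this.integrableOn_compact isCompact_Icc).mono_set Set.Ioo_subset_Icc_self
  · exact (aux_log hs he).1.const_mul _

theorem aux_int {s lam C : ℝ} {k : ℝ → ℂ} (hk : ContinuousOn k (Set.Icc (-s) s))
    (hC : ∀ w ∈ Set.Icc (-s) s, ‖k w‖ ≤ C * |w - lam|) :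
    IntegrableOn (fun w : ℝ => k w / ((w:ℂ) - (lam:ℂ))) (Set.Ioo (-s) s) := by
  have hkm : AEStronglyMeasurable k (volume.restrict (Set.Ioo (-s) s)) :=
    (hk.mono Set.Ioo_subset_Icc_self).aestronglyMeasurable measurableSet_Ioo
  refine Integrable.mono' (g := fun _ => |C|) (integrable_const _) ?_ ?_
  · exact hkm.div₀ 
      (by fun_prop : Continuous fun w : ℝ => (w:ℂ) - (lam:ℂ)).aestronglyMeasurable
  · refine (ae_restrict_iff' measurableSet_Ioo).2 (Eventually.of_forall fun w hw => ?_)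
    rw [norm_div]
    apply div_le_of_le_mul₀ (norm_nonneg _) (abs_nonneg _)
    refine (hC w (Set.Ioo_subset_Icc_self hw)).trans ?_
    refine mul_le_mul (le_abs_self _) ?_ (abs_nonneg _) (abs_nonneg _)
    simpa using aux_norm_ge w lam 0

/-- Lemma 2: the function `Y` built from the resolvent functions `F = (I-K)⁻¹f` of an
integrable operator has boundary values on `(-s,s)` solving the jump relation
`Y₊ = Y₋ (I - 2πi f hᵗ)`, and `Y₊ f = Y₋ f = F`. -/
theorem integrable_operator_RHP (s : ℝ) (hs : 0 < s) (M : ℕ) (hM : 1 ≤ M)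
    (f h : Fin M → ℝ → ℂ)
    (U : Set ℝ) (hU : IsOpen U) (hUs : Set.Icc (-s) s ⊆ U)
    (hf : ∀ i, ContDiffOn ℝ (⊤ : ℕ∞) (f i) U) (hh : ∀ i, ContDiffOn ℝ (⊤ : ℕ∞) (h i) U)
    (hcancel : ∀ lam : ℝ, ∑ i, f i lam * h i lam = 0)
    -- the integral operator K on L²((-s,s)) ...
    (T : Lp ℂ 2 (volume.restrict (Set.Ioo (-s) s)) →L[ℂ]
         Lp ℂ 2 (volume.restrict (Set.Ioo (-s) s)))
    (hT : ∀ φ : Lp ℂ 2 (volume.restrict (Set.Ioo (-s) s)),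
      (T φ : ℝ → ℂ) =ᵐ[volume.restrict (Set.Ioo (-s) s)]
        fun lam => ∫ mu_ in Set.Ioo (-s) s, intKernel f h lam mu_ * (φ : ℝ → ℂ) mu_)
    -- ... such that I - K has a bounded inverse
    (Tinv : Lp ℂ 2 (volume.restrict (Set.Ioo (-s) s)) →L[ℂ]
            Lp ℂ 2 (volume.restrict (Set.Ioo (-s) s)))
    (hTinv₁ : (1 - T) * Tinv = 1) (hTinv₂ : Tinv * (1 - T) = 1)
    -- F = (I-K)⁻¹f, entrywise
    (F : Fin M → ℝ → ℂ)
    (hFcont : ∀ i, ContinuousOn (F i) (Set.Icc (-s) s))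
    (hFeq : ∀ i, ∀ lam ∈ Set.Icc (-s) s,
      F i lam - (∫ mu_ in Set.Ioo (-s) s, intKernel f h lam mu_ * F i mu_) = f i lam) :
    ∀ lam ∈ Set.Ioo (-s) s, ∃ Yp Ym : Matrix (Fin M) (Fin M) ℂ,
      Tendsto (fun ε : ℝ => Ymat s F h (((lam:ℝ):ℂ) + (ε:ℂ) * Complex.I))
        (nhdsWithin 0 (Set.Ioi 0)) (nhds Yp) ∧
      Tendsto (fun ε : ℝ => Ymat s F h (((lam:ℝ):ℂ) - (ε:ℂ) * Complex.I))
        (nhdsWithin 0 (Set.Ioi 0)) (nhds Ym) ∧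
      Yp = Ym * (1 - (2*(Real.pi:ℂ)*Complex.I) • Matrix.of (fun i j => f i lam * h j lam)) ∧
      Yp.mulVec (fun i => f i lam) = (fun i => F i lam) ∧
      Ym.mulVec (fun i => f i lam) = (fun i => F i lam) := by
  intro lam hl
  have hl' := Set.Ioo_subset_Icc_self hl
  obtain ⟨c, hcp, hcm⟩ := aux_log_lim hs hl
  have hhc : ∀ i, ContinuousOn (h i) (Set.Icc (-s) s) := fun i => (hh i).continuousOn.mono hUs
  have hgc : ∀ i j, ContinuousOn (fun w => F i w * h j w) (Set.Icc (-s) s) :=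
    fun i j => (hFcont i).mul (hhc j)
  choose LF hLF using fun i => aux_F_lip hs hU hUs hf hh hcancel (hf i) (hFcont i) (hFeq i)
  choose LH hLH using fun i => aux_lip hU hUs (hh i)
  choose B hB using fun i => isCompact_Icc.exists_bound_of_continuousOn (hFcont i)
  have hlip : ∀ i j, ∀ w ∈ Set.Icc (-s) s, ‖F i w * h j w - F i lam * h j lam‖ ≤
      (B i * LH j + LF i * ‖h j lam‖) * |w - lam| := by
    intro i j w hw
    have e : F i w * h j w - F i lam * h j lam =
      F i w * (h j w - h j lam) + (F i w - F i lam) * h j lam := by ring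
    rw [e]
    refine (norm_add_le _ _).trans ?_
    rw [norm_mul, norm_mul]
    have h1 := hLH j w hw lam hl'
    have h2 := hLF i w hw lam hl'
    have h3 := hB i w hw
    have h4 := mul_le_mul h3 h1 (norm_nonneg _) ((norm_nonneg _).trans h3)
    have h5 := mul_le_mul_of_nonneg_right h2 (norm_nonneg (h j lam))
    calc _ ≤ _ := add_le_add h4 h5
      _ = _ := by ring
  have hkc : ∀ i j, ContinuousOn (fun w => F i w * h j w - F i lam * h j lam)
      (Set.Icc (-s) s) := fun i j => (hgc i j).sub continuousOn_const
  set D : Fin M → Fin M → ℂ := fun i j =>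
    ∫ w in Set.Ioo (-s) s, (F i w * h j w - F i lam * h j lam) / ((w:ℂ) - (lam:ℂ)) with hD
  have hdct := fun i j => aux_dct (hkc i j) (hlip i j)
  have hp : ∀ i j, Tendsto (fun e : ℝ => ∫ w in Set.Ioo (-s) s,
      F i w * h j w / ((w:ℂ) - ((lam:ℂ) + (e:ℂ) * Complex.I))) (𝓝[>] 0)
      (𝓝 (D i j + F i lam * h j lam * (c + Real.pi * Complex.I))) := by
    intro i j
    refine Tendsto.congr' ?_ (((hdct i j).mono_left nhdsWithin_le_nhds).add
      (hcp.const_mul (F i lam * h j lam)))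
    filter_upwards [self_mem_nhdsWithin] with e he
    exact (aux_split (C := 0) hs (hgc i j) (ne_of_gt he)).symm
  have hm : ∀ i j, Tendsto (fun e : ℝ => ∫ w in Set.Ioo (-s) s,
      F i w * h j w / ((w:ℂ) - ((lam:ℂ) + (e:ℂ) * Complex.I))) (𝓝[<] 0)
      (𝓝 (D i j + F i lam * h j lam * (c - Real.pi * Complex.I))) := by
    intro i j
    refine Tendsto.congr' ?_ (((hdct i j).mono_left nhdsWithin_le_nhds).add
      (hcm.const_mul (F i lam * h j lam)))
    filter_upwards [self_mem_nhdsWithin] with e he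
    exact (aux_split (C := 0) hs (hgc i j) (ne_of_lt he)).symm
  have hDf : ∀ i, ∑ j, D i j * f j lam = f i lam - F i lam := by
    intro i
    have hI := fun j => aux_int (hkc i j) (hlip i j)
    have e1 : ∑ j, D i j * f j lam = ∫ w in Set.Ioo (-s) s,
        ∑ j, (F i w * h j w - F i lam * h j lam) / ((w:ℂ) - (lam:ℂ)) * f j lam := by
      rw [integral_finsetSum _ (fun j _ => (hI j).mul_const _)]
      exact Finset.sum_congr rfl fun j _ => (integral_mul_const _ _).symm
    have e2 : ∫ w in Set.Ioo (-s) s,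
        ∑ j, (F i w * h j w - F i lam * h j lam) / ((w:ℂ) - (lam:ℂ)) * f j lam =
        ∫ w in Set.Ioo (-s) s, -(intKernel f h lam w * F i w) := by
      apply integral_congr_ae
      refine ae_restrict_of_ae ?_
      have : ∀ᵐ w : ℝ, w ≠ lam := by simp [ae_iff]
      filter_upwards [this] with w hw
      have hc1 : ((w:ℝ):ℂ) - ((lam:ℝ):ℂ) ≠ 0 := by
        rw [← Complex.ofReal_sub]; exact_mod_cast sub_ne_zero.2 hw
      have hc2 : ((lam:ℝ):ℂ) - ((w:ℝ):ℂ) ≠ 0 := by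
        rw [← neg_sub]; exact neg_ne_zero.2 hc1
      have e3 : ∑ j, (F i w * h j w - F i lam * h j lam) / ((w:ℂ) - (lam:ℂ)) * f j lam =
          (F i w * (∑ j, f j lam * h j w) - F i lam * ∑ j, f j lam * h j lam) /
            ((w:ℂ) - (lam:ℂ)) := by
        rw [Finset.mul_sum, Finset.mul_sum, ← Finset.sum_sub_distrib, Finset.sum_div]
        exact Finset.sum_congr rfl fun j _ => by ring
      rw [e3, hcancel lam, intKernel, if_neg (Ne.symm hw)]
      rw [← neg_sub (w:ℂ) (lam:ℂ), div_neg]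
      ring
    rw [e1, e2, integral_neg, ← hFeq i lam hl']
    ring
  have hmul : ∀ (a : ℂ) (i : Fin M), ((1 - Matrix.of fun i j => D i j + F i lam * h j lam * a :
      Matrix (Fin M) (Fin M) ℂ).mulVec (fun i => f i lam)) i = F i lam := by
    intro a i
    rw [Matrix.sub_mulVec, Matrix.one_mulVec, Pi.sub_apply]
    simp only [Matrix.mulVec, dotProduct, Matrix.of_apply]
    have : ∑ j, (D i j + F i lam * h j lam * a) * f j lam =
        ∑ j, D i j * f j lam + F i lam * a * ∑ j, f j lam * h j lam := by
      rw [Finset.mul_sum, ← Finset.sum_add_distrib]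
      exact Finset.sum_congr rfl fun j _ => by ring
    rw [this, hDf, hcancel]
    ring
  refine ⟨1 - Matrix.of fun i j => D i j + F i lam * h j lam * (c + Real.pi * Complex.I),
    1 - Matrix.of fun i j => D i j + F i lam * h j lam * (c - Real.pi * Complex.I),
    ?_, ?_, ?_, funext (hmul _), funext (hmul _)⟩
  · unfold Ymat
    refine Tendsto.sub tendsto_const_nhds ?_
    refine tendsto_pi_nhds.2 fun i => tendsto_pi_nhds.2 fun j => ?_
    exact hp i j
  · unfold Ymat
    refine Tendsto.sub tendsto_const_nhds ?_
    refine tendsto_pi_nhds.2 fun i => tendsto_pi_nhds.2 fun j => ?_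
    have hneg : Tendsto (fun e : ℝ => -e) (𝓝[>] 0) (𝓝[<] 0) := by
      simpa using tendsto_neg_nhdsGT (a := (0:ℝ))
    refine ((hm i j).comp hneg).congr fun e => ?_
    simp [sub_eq_add_neg]
  · rw [mul_sub, mul_one, Matrix.mul_smul]
    ext i j
    have e := hmul (c - Real.pi * Complex.I) i
    have e2 : ((1 - Matrix.of fun i j => D i j + F i lam * h j lam * (c - Real.pi * Complex.I) :
      Matrix (Fin M) (Fin M) ℂ) * Matrix.of (fun i j => f i lam * h j lam)) i j =
        F i lam * h j lam := by
      rw [← e, Matrix.mul_apply]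
      simp only [Matrix.mulVec, dotProduct, Matrix.of_apply]
      rw [Finset.sum_mul]
      exact Finset.sum_congr rfl fun k _ => by ring
    rw [Matrix.sub_apply _ (_ • _), Matrix.smul_apply, e2]
    simp only [Matrix.sub_apply, Matrix.of_apply, smul_eq_mul]
    ring


end
end

section
/- Define $\beta(z) := \bigl(\tfrac{z+1}{z-1}\bigr)^{1/4}$ for $z\in\mathbb{C}\setminus[-1,1]$ using the principal complex power (note $\tfrac{z+1}{z-1}\in\mathbb{C}\setminus(-\infty,0]$ there), and $M(z) := \tfrac{1}{2}\begin{pmatrix}\beta(z)+\beta(z)^{-1} & \beta(z)-\beta(z)^{-1}\\ \beta(z)-\beta(z)^{-1} & \beta(z)+\beta(z)^{-1}\end{pmatrix}$. Then: (i) $M$ is holomorphic on $\mathbb{C}\setminus[-1,1]$; (ii) for every $x_0\in(-1,1)$ the boundary values $M_\pm(x_0):=\lim_{\varepsilon\downarrow 0}M(x_0\pm i\varepsilon)$ exist and satisfy the jump relation $M_+(x_0) = M_-(x_0)\begin{pmatrix}0 & -i\\ -i & 0\end{pmatrix}$; (iii) $M(z)\to I$ as $z\to\infty$; (iv) $\det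 M(z) = 1$ for all $z\in\mathbb{C}\setminus[-1,1]$. -/
noncomputable section
open Filter Topology

/-- The cut `[-1,1]` viewed as a subset of ℂ. -/
def Cut : Set ℂ := (fun x : ℝ => (x:ℂ)) '' Set.Icc (-1) 1

/-- `β(z) = ((z+1)/(z-1))^{1/4}` (principal branch). -/
def betaF (z : ℂ) : ℂ := ((z+1)/(z-1)) ^ ((1:ℂ)/4)

/-- The model Riemann-Hilbert solution `M(z)`. -/
def Mmod (z : ℂ) : Matrix (Fin 2) (Fin 2) ℂ :=
  (1/2 : ℂ) • !![betaF z + (betaF z)⁻¹, betaF z - (betaF z)⁻¹;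
                 betaF z - (betaF z)⁻¹, betaF z + (betaF z)⁻¹]

theorem w_mem_slitPlane {z : ℂ} (hz : z ∈ Cutᶜ) : (z+1)/(z-1) ∈ Complex.slitPlane := by
  by_contra h
  apply hz
  have h1 : z - 1 ≠ 0 := by
    intro h0
    apply hz
    exact ⟨1, by norm_num, by simp [sub_eq_zero.1 h0]⟩
  rw [Complex.mem_slitPlane_iff_not_le_zero, not_not, Complex.le_def] at h
  obtain ⟨hre, him⟩ := h
  obtain ⟨t, ht⟩ : ∃ t : ℝ, (z+1)/(z-1) = (t : ℂ) :=
    ⟨((z+1)/(z-1)).re, Complex.ext (by simp) (by simpa using him)⟩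
  rw [ht] at hre
  have ht0 : t ≤ 0 := by simpa using hre
  have e : z + 1 = t * (z - 1) := by rw [← ht]; field_simp
  have h2 : (1:ℝ) - t ≠ 0 := by linarith
  have h3 : (1:ℂ) - t ≠ 0 := by exact_mod_cast h2
  have h4 : 0 < 1 - t := by linarith
  refine ⟨-(1+t)/(1-t), ⟨?_, ?_⟩, ?_⟩
  · rw [le_div_iff₀ h4]; linarith
  · rw [div_le_iff₀ h4]; linarith
  · push_cast
    rw [div_eq_iff h3]
    linear_combination -e

theorem betaF_ne_zero {z : ℂ} (hz : z ∈ Cutᶜ) : betaF z ≠ 0 := by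
  have := Complex.slitPlane_ne_zero (w_mem_slitPlane hz)
  unfold betaF
  rw [Complex.cpow_def_of_ne_zero this]
  exact Complex.exp_ne_zero _

theorem betaF_differentiableOn : DifferentiableOn ℂ betaF Cutᶜ := by
  intro z hz
  have h1 : z - 1 ≠ 0 := by
    intro h0
    apply hz
    exact ⟨1, by norm_num, by simp [sub_eq_zero.1 h0]⟩
  apply DifferentiableAt.differentiableWithinAt
  unfold betaF
  refine DifferentiableAt.cpow ?_ (differentiableAt_const _) (w_mem_slitPlane hz)
  exact DifferentiableAt.div (by fun_prop) (by fun_prop) h1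

/-- The model matrix as a function of the value of `β`. -/
def Mb (b : ℂ) : Matrix (Fin 2) (Fin 2) ℂ :=
  (1/2 : ℂ) • !![b + b⁻¹, b - b⁻¹; b - b⁻¹, b + b⁻¹]

theorem tendsto_Mb {α : Type*} {l : Filter α} {f : α → ℂ} {b : ℂ}
    (hb : b ≠ 0) (hf : Tendsto (fun a => betaF (f a)) l (nhds b)) :
    Tendsto (fun a => Mmod (f a)) l (nhds (Mb b)) := by
  have hi := hf.inv₀ hb
  refine tendsto_pi_nhds.2 ?_
  intro i
  refine tendsto_pi_nhds.2 ?_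
  intro j
  fin_cases i <;> fin_cases j <;> simp [Mmod, Mb]
  · exact (hf.add hi).const_mul _
  · exact (hf.sub hi).const_mul _
  · exact (hf.sub hi).const_mul _
  · exact (hf.add hi).const_mul _

theorem Mb_jump {b c : ℂ} (h : c = -Complex.I * b) :
    Mb c = Mb b * !![0, -Complex.I; -Complex.I, 0] := by
  have hi : c⁻¹ = Complex.I * b⁻¹ := by
    rw [h, mul_inv, inv_neg, Complex.inv_I, neg_neg]
  ext i j
  fin_cases i <;> fin_cases j <;>
    simp [Mb, Matrix.mul_apply, Fin.sum_univ_two, hi] <;> rw [h] <;> ring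

theorem w_im (x ε : ℝ) : (((x:ℂ) + (ε:ℂ) * Complex.I + 1)/((x:ℂ) + (ε:ℂ) * Complex.I - 1)).im
    = -2 * ε / ((x - 1)^2 + ε^2) := by
  rw [Complex.div_im]
  simp [Complex.normSq_apply]
  rw [← sub_div]
  congr 1 <;> ring

theorem w_tendsto {x : ℝ} (hx : x ∈ Set.Ioo (-1:ℝ) 1) :
    Tendsto (fun ε : ℝ => ((x:ℂ) + (ε:ℂ) * Complex.I + 1)/((x:ℂ) + (ε:ℂ) * Complex.I - 1))
      (nhds 0) (nhds (((x+1)/(x-1) : ℝ) : ℂ)) := by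
  have h : (x:ℂ) - 1 ≠ 0 := by
    have : x - 1 ≠ 0 := by linarith [hx.2]
    exact_mod_cast this
  have hc : ContinuousAt (fun ε : ℝ =>
      ((x:ℂ) + (ε:ℂ) * Complex.I + 1)/((x:ℂ) + (ε:ℂ) * Complex.I - 1)) 0 := by
    apply ContinuousAt.div
    · fun_prop
    · fun_prop
    · simpa using h
  have := hc.tendsto
  simpa using this

theorem betaF_of_log {α : Type*} {l : Filter α} {f : α → ℂ} {L : ℂ} {w : ℂ} (hw : w ≠ 0)
    (h0 : Tendsto (fun a => (f a + 1)/(f a - 1)) l (nhds w))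
    (h : Tendsto (fun a => Complex.log ((f a + 1)/(f a - 1))) l (nhds L)) :
    Tendsto (fun a => betaF (f a)) l (nhds (Complex.exp (L * (1/4)))) := by
  have h1 := (Complex.continuous_exp.tendsto _).comp (h.mul_const ((1:ℂ)/4))
  refine h1.congr' ?_
  filter_upwards [h0.eventually_ne hw] with a ha
  simp only [Function.comp, betaF]
  rw [Complex.cpow_def_of_ne_zero ha]

theorem jump_part (x : ℝ) (hx : x ∈ Set.Ioo (-1:ℝ) 1) : ∃ Mp Mm : Matrix (Fin 2) (Fin 2) ℂ,
      Tendsto (fun ε : ℝ => Mmod ((x:ℂ) + (ε:ℂ) * Complex.I))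
        (nhdsWithin 0 (Set.Ioi 0)) (nhds Mp) ∧
      Tendsto (fun ε : ℝ => Mmod ((x:ℂ) - (ε:ℂ) * Complex.I))
        (nhdsWithin 0 (Set.Ioi 0)) (nhds Mm) ∧
      Mp = Mm * !![0, -Complex.I; -Complex.I, 0] := by
  have hneg : (x+1)/(x-1) < 0 := div_neg_of_pos_of_neg (by linarith [hx.1]) (by linarith [hx.2])
  have hw0 : (((x+1)/(x-1) : ℝ) : ℂ) ≠ 0 := by exact_mod_cast hneg.ne
  have hp0 := (w_tendsto hx).mono_left (nhdsWithin_le_nhds (s := Set.Ioi 0))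
  have hm0 : Tendsto (fun ε : ℝ =>
      ((x:ℂ) - (ε:ℂ) * Complex.I + 1)/((x:ℂ) - (ε:ℂ) * Complex.I - 1))
      (nhdsWithin 0 (Set.Ioi 0)) (nhds (((x+1)/(x-1) : ℝ) : ℂ)) := by
    have hn : Tendsto (fun ε : ℝ => -ε) (nhds 0) (nhds 0) := by
      simpa using (continuous_neg (G := ℝ)).tendsto 0
    have := ((w_tendsto hx).comp hn).mono_left (nhdsWithin_le_nhds (s := Set.Ioi 0))
    refine this.congr ?_
    intro ε
    simp [sub_eq_add_neg]
  have hden : (0:ℝ) < (x-1)^2 := by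
    have : x - 1 ≠ 0 := by linarith [hx.2]
    positivity
  have hlp := (Complex.tendsto_log_nhdsWithin_im_neg_of_re_neg_of_im_zero
    (z := (((x+1)/(x-1) : ℝ) : ℂ)) (by rw [Complex.ofReal_re]; exact hneg)
    (Complex.ofReal_im _)).comp
    (tendsto_nhdsWithin_iff.2 ⟨hp0, by
      filter_upwards [self_mem_nhdsWithin] with ε hε
      have hε' : 0 < ε := hε
      rw [w_im]
      exact div_neg_of_neg_of_pos (by linarith) (by positivity)⟩)
  have hlm := (Complex.tendsto_log_nhdsWithin_im_nonneg_of_re_neg_of_im_zero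
    (z := (((x+1)/(x-1) : ℝ) : ℂ)) (by rw [Complex.ofReal_re]; exact hneg)
    (Complex.ofReal_im _)).comp
    (tendsto_nhdsWithin_iff.2 ⟨hm0, by
      filter_upwards [self_mem_nhdsWithin] with ε hε
      have hε' : 0 < ε := hε
      have := w_im x (-ε)
      rw [Complex.ofReal_neg, neg_mul, ← sub_eq_add_neg] at this
      rw [this]
      exact div_nonneg (by linarith) (by positivity)⟩)
  refine ⟨_, _, tendsto_Mb (Complex.exp_ne_zero _) (betaF_of_log hw0 hp0 hlp),
    tendsto_Mb (Complex.exp_ne_zero _) (betaF_of_log hw0 hm0 hlm), Mb_jump ?_⟩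
  rw [← Complex.exp_neg_pi_div_two_mul_I, ← Complex.exp_add]
  congr 1
  ring

theorem infinity_part : Tendsto Mmod (Bornology.cobounded ℂ) (nhds 1) := by
  have h1 : Tendsto (fun z : ℂ => z - 1) (Bornology.cobounded ℂ) (Bornology.cobounded ℂ) := by
    rw [← tendsto_norm_atTop_iff_cobounded]
    refine tendsto_atTop_mono (f := fun z : ℂ => ‖z‖ + (-1)) ?_
      (tendsto_atTop_add_const_right _ _ tendsto_norm_cobounded_atTop)
    intro z
    have := norm_sub_norm_le z 1
    simp only [norm_one] at this
    linarith
  have h2 := (Filter.tendsto_inv₀_cobounded.comp h1).const_mul 2 |>.const_add 1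
  have h3 : Tendsto (fun z : ℂ => (z + 1)/(z - 1)) (Bornology.cobounded ℂ) (nhds 1) := by
    rw [mul_zero, add_zero] at h2
    refine h2.congr' ?_
    filter_upwards [h1.eventually (Bornology.eventually_ne_cobounded (0:ℂ))] with z hz
    simp only [Function.comp]
    field_simp
    ring
  have h4 := betaF_of_log one_ne_zero h3
    ((continuousAt_clog Complex.one_mem_slitPlane).tendsto.comp h3)
  have h5 := tendsto_Mb (Complex.exp_ne_zero _) h4
  have : Mb (Complex.exp (Complex.log 1 * (1/4))) = 1 := by
    ext i j
    fin_cases i <;> fin_cases j <;> simp [Mb] <;> norm_num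
  rwa [this] at h5

/-- The model Riemann-Hilbert problem on `[-1,1]`: `M` is holomorphic off the cut,
has boundary values satisfying the jump `M₊ = M₋ [[0,-i],[-i,0]]` on `(-1,1)`,
tends to `I` at infinity, and is unimodular. -/
theorem model_RHP_solution :
    -- (i) M is holomorphic on ℂ \ [-1,1]
    (∀ i j : Fin 2, DifferentiableOn ℂ (fun z => Mmod z i j) Cutᶜ) ∧
    -- (ii) boundary values and jump relation on (-1,1)
    (∀ x0 ∈ Set.Ioo (-1:ℝ) 1, ∃ Mp Mm : Matrix (Fin 2) (Fin 2) ℂ,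
      Tendsto (fun ε : ℝ => Mmod ((x0:ℂ) + (ε:ℂ) * Complex.I))
        (nhdsWithin 0 (Set.Ioi 0)) (nhds Mp) ∧
      Tendsto (fun ε : ℝ => Mmod ((x0:ℂ) - (ε:ℂ) * Complex.I))
        (nhdsWithin 0 (Set.Ioi 0)) (nhds Mm) ∧
      Mp = Mm * !![0, -Complex.I; -Complex.I, 0]) ∧
    -- (iii) M(z) → I as z → ∞
    Tendsto Mmod (Bornology.cobounded ℂ) (nhds 1) ∧
    -- (iv) det M ≡ 1 off the cut
    (∀ z ∈ Cutᶜ, (Mmod z).det = 1) := by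
  refine ⟨?_, jump_part, infinity_part, ?_⟩
  · have hb := betaF_differentiableOn
    have hi : DifferentiableOn ℂ (fun z => (betaF z)⁻¹) Cutᶜ := hb.inv (fun z hz => betaF_ne_zero hz)
    intro i j
    fin_cases i <;> fin_cases j <;> simp [Mmod]
    · exact (hb.add hi).const_mul _
    · exact (hb.sub hi).const_mul _
    · exact (hb.sub hi).const_mul _
    · exact (hb.add hi).const_mul _
  · intro z hz
    have h := betaF_ne_zero hz
    simp [Mmod, Matrix.det_fin_two]
    field_simp
    ring

end
end

section
/- Let $t\ge 0$ and $c\in\mathbb{R}$ with $\tfrac{t}{2}+c>0$. Define $r(z) := (z-1)^{1/2}(z+1)^{1/2}$ for $z\in\mathbb{C}\setminus[-1,1]$ (principal branches of the square roots) and $\hat{g}(z) := \tfrac{4i}{3}\,r(z)\,\bigl(t z^2 + \tfrac{t}{2} + c\bigr)$. Then: (i) $r$, and hence $\hat{g}$, is holomorphic on $\mathbb{C}\setminus[-1,1]$ and $r(z)/z \to 1$ as $z\to\infty$; (ii) for every $x_0\in(-1,1)$ the boundary values $\hat{g}_\pm(x_0):=\lim_{\varepsilon\downarrow 0}\hat{g}(x_0\pm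 i\varepsilon)$ exist, satisfy $\hat{g}_+(x_0) + \hat{g}_-(x_0) = 0$, and $\hat{g}_+(x_0) = -\tfrac{4}{3}\sqrt{1-x_0^2}\,\bigl(t x_0^2 + \tfrac{t}{2} + c\bigr)$ is a negative real number; (iii) $\hat{g}(z) - i\bigl(\tfrac{4}{3}t z^3 + \tfrac{4}{3}c\, z\bigr) \to 0$ as $z\to\infty$. -/
noncomputable section
open Filter Topology

/-- `r(z) = (z-1)^{1/2}(z+1)^{1/2}` (principal branches). -/
def rfun (z : ℂ) : ℂ := (z - 1) ^ ((1:ℂ)/2) * (z + 1) ^ ((1:ℂ)/2)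

/-- The g-function `ĝ(z) = (4i/3) r(z) (t z² + t/2 + c)`. -/
def ghat (t c : ℝ) (z : ℂ) : ℂ :=
  (4*Complex.I/3) * rfun z * ((t:ℂ)*z^2 + (t:ℂ)/2 + (c:ℂ))

lemma rfun_alt (z : ℂ) (hz : z ∉ Cut) :
    rfun z = (z + 1) * ((z - 1) / (z + 1)) ^ ((1:ℂ)/2) := by
  have h1 : z - 1 ≠ 0 := by
    intro h
    exact hz ⟨1, by norm_num, by simp; linear_combination -h⟩
  have h2 : z + 1 ≠ 0 := by
    intro h
    exact hz ⟨-1, by norm_num, by simp; linear_combination -h⟩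
  have hlog : Complex.log ((z - 1) / (z + 1)) = Complex.log (z - 1) - Complex.log (z + 1) := by
    have : (z - 1) / (z + 1) = Complex.exp (Complex.log (z - 1) - Complex.log (z + 1)) := by
      rw [Complex.exp_sub, Complex.exp_log h1, Complex.exp_log h2]
    rw [this, Complex.log_exp]
    · simp only [Complex.sub_im, Complex.log_im]
      have a1 := Complex.neg_pi_lt_arg (z - 1)
      have a2 := Complex.arg_le_pi (z + 1)
      rcases le_or_gt 0 z.im with h | h
      · have b1 : 0 ≤ (z - 1).arg := Complex.arg_nonneg_iff.2 (by simpa using h)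
        by_contra hcon
        have e1 : (z - 1).arg = 0 := by linarith
        have e2 : (z + 1).arg = Real.pi := by linarith
        rw [Complex.arg_eq_zero_iff] at e1
        rw [Complex.arg_eq_pi_iff] at e2
        have := e1.1
        have := e2.1
        simp at *
        linarith
      · have b2 : (z + 1).arg < 0 := Complex.arg_neg_iff.2 (by simpa using h)
        linarith
    · simp only [Complex.sub_im, Complex.log_im]
      have a1 := Complex.arg_le_pi (z - 1)
      have a2 := Complex.neg_pi_lt_arg (z + 1)
      rcases le_or_gt 0 z.im with h | h
      · have b2 : 0 ≤ (z + 1).arg := Complex.arg_nonneg_iff.2 (by simpa using h)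
        linarith
      · have b1 : (z - 1).arg < 0 := Complex.arg_neg_iff.2 (by simpa using h)
        linarith
  have hq : (z - 1) / (z + 1) ≠ 0 := div_ne_zero h1 h2
  unfold rfun
  rw [Complex.cpow_def_of_ne_zero h1, Complex.cpow_def_of_ne_zero h2,
    Complex.cpow_def_of_ne_zero hq, hlog]
  have e : (z + 1) * Complex.exp ((Complex.log (z - 1) - Complex.log (z + 1)) * (1/2)) =
      Complex.exp (Complex.log (z + 1)) *
        Complex.exp ((Complex.log (z - 1) - Complex.log (z + 1)) * (1/2)) := by
    rw [Complex.exp_log h2]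
  rw [e, ← Complex.exp_add, ← Complex.exp_add]
  congr 1
  ring

lemma quot_slit (z : ℂ) (hz : z ∉ Cut) : (z - 1) / (z + 1) ∈ Complex.slitPlane := by
  have h2 : z + 1 ≠ 0 := by
    intro h
    exact hz ⟨-1, by norm_num, by simp; linear_combination -h⟩
  by_contra hcon
  rw [Complex.mem_slitPlane_iff] at hcon
  push Not at hcon
  obtain ⟨hre, him⟩ := hcon
  set w := (z - 1) / (z + 1) with hw
  have hwr : w = ((w.re : ℝ) : ℂ) := Complex.ext (by simp) (by simpa using him)
  set u := w.re with hu
  have e : z - 1 = u * (z + 1) := by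
    rw [← hwr, hw, div_mul_cancel₀ _ h2]
  have hu1 : (1 - u : ℝ) ≠ 0 := by linarith
  have hu1' : (1 - u : ℂ) ≠ 0 := by exact_mod_cast hu1
  apply hz
  refine ⟨(1 + u) / (1 - u), ⟨?_, ?_⟩, ?_⟩
  · rw [le_div_iff₀ (by linarith)]; linarith
  · rw [div_le_iff₀ (by linarith)]; linarith
  · simp only
    push_cast
    rw [div_eq_iff hu1']
    linear_combination -e

lemma rfun_diff : DifferentiableOn ℂ rfun Cutᶜ := by
  have : DifferentiableOn ℂ (fun z : ℂ => (z + 1) * ((z - 1) / (z + 1)) ^ ((1:ℂ)/2)) Cutᶜ := by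
    intro z hz
    have h2 : z + 1 ≠ 0 := by
      intro h
      exact hz ⟨-1, by norm_num, by simp; linear_combination -h⟩
    apply DifferentiableAt.differentiableWithinAt
    apply DifferentiableAt.mul (by fun_prop)
    have hd : DifferentiableAt ℂ (fun z : ℂ => (z - 1) / (z + 1)) z :=
      DifferentiableAt.div (by fun_prop) (by fun_prop) h2
    exact hd.cpow_const (quot_slit z hz)
  exact this.congr fun z hz => rfun_alt z hz

lemma rfun_sq (z : ℂ) : rfun z ^ 2 = z ^ 2 - 1 := by
  unfold rfun
  have h (w : ℂ) : (w ^ ((1:ℂ)/2)) ^ 2 = w := by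
    have := Complex.cpow_nat_inv_pow w (n := 2) (by norm_num)
    simpa using this
  rw [mul_pow, h, h]; ring

lemma eventually_big : ∀ᶠ z : ℂ in Bornology.cobounded ℂ, z ∉ Cut ∧ z ≠ 0 ∧ z + 1 ≠ 0 := by
  have h : ∀ᶠ z : ℂ in Bornology.cobounded ℂ, 1 < ‖z‖ :=
    tendsto_norm_cobounded_atTop.eventually_gt_atTop 1
  filter_upwards [h] with z hz
  refine ⟨?_, ?_, ?_⟩
  · rintro ⟨x, hx, rfl⟩
    simp only [Complex.norm_real, Real.norm_eq_abs] at hz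
    have := abs_le.2 hx
    linarith
  · rintro rfl
    simp at hz
    linarith
  · intro h
    have : z = -1 := by linear_combination h
    subst this
    simp at hz

lemma inv_tend : Tendsto (fun z : ℂ => z⁻¹) (Bornology.cobounded ℂ) (nhds 0) :=
  tendsto_inv₀_cobounded

lemma rfun_tend : Tendsto (fun z => rfun z / z) (Bornology.cobounded ℂ) (nhds 1) := by
  have hc : ContinuousAt (fun w : ℂ => (1 + w) * ((1 - w) / (1 + w)) ^ ((1:ℂ)/2)) 0 := by
    apply ContinuousAt.mul (by fun_prop)
    apply ContinuousAt.cpow _ continuousAt_const (by simp)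
    exact ContinuousAt.div (by fun_prop) (by fun_prop) (by simp)
  have h := hc.tendsto.comp inv_tend
  simp only [add_zero, sub_zero, div_one, Complex.one_cpow, mul_one] at h
  refine h.congr' ?_
  filter_upwards [eventually_big] with z ⟨h1, h2, h3⟩
  simp only [Function.comp]
  rw [rfun_alt z h1]
  have e : (1 - z⁻¹) / (1 + z⁻¹) = (z - 1) / (z + 1) := by
    have : 1 + z⁻¹ = (z + 1) / z := by field_simp
    rw [this]
    field_simp
  rw [e]
  field_simp

lemma ghat_tend (t c : ℝ) :
    Tendsto (fun z : ℂ => ghat t c z - Complex.I * ((4/3)*(t:ℂ)*z^3 + (4/3)*(c:ℂ)*z))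
      (Bornology.cobounded ℂ) (nhds 0) := by
  have hw := rfun_tend
  have hF : ContinuousAt (fun p : ℂ × ℂ => (4*Complex.I/3) *
      ((t:ℂ) * (-(p.1 + 2) * p.2 / (2 * (p.1 + 1)^2)) + (c:ℂ) * (-p.2 / (p.1 + 1)))) (1, 0) := by
    refine ContinuousAt.mul continuousAt_const (ContinuousAt.add
      (ContinuousAt.mul continuousAt_const (ContinuousAt.div (by fun_prop) (by fun_prop) ?_))
      (ContinuousAt.mul continuousAt_const (ContinuousAt.div (by fun_prop) (by fun_prop) ?_)))
    · norm_num
    · norm_num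
  have h := hF.tendsto.comp (hw.prodMk_nhds inv_tend)
  simp only [mul_zero, neg_zero, zero_div, add_zero] at h
  refine h.congr' ?_
  have hne : ∀ᶠ z : ℂ in Bornology.cobounded ℂ, rfun z / z ≠ -1 :=
    hw.eventually_ne (by norm_num)
  filter_upwards [eventually_big, hne] with z ⟨h1, h2, h3⟩ h4
  simp only [Function.comp]
  set w := rfun z / z with hwd
  have hr : rfun z = w * z := by rw [hwd]; field_simp
  have hs := rfun_sq z
  rw [hr] at hs
  clear_value w
  have h5 : w + 1 ≠ 0 := fun h => h4 (by linear_combination h)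
  unfold ghat
  rw [hr]
  have k1 : -z⁻¹ / (w + 1) = w * z - z := by
    field_simp
    linear_combination -hs
  have k2 : -(w + 2) * z⁻¹ / (2 * (w + 1)^2) = z^2 * (w * z - z) + w * z / 2 := by
    have : -(w + 2) * z⁻¹ / (2 * (w + 1)^2) = (w + 2) / (2 * (w + 1)) * (-z⁻¹ / (w + 1)) := by
      field_simp
    rw [this, k1]
    field_simp
    linear_combination (-2) * hs
  rw [k1, k2]
  ring

lemma ghat_conj (t c : ℝ) (z : ℂ) (hz : z.im ≠ 0) :
    ghat t c (starRingEnd ℂ z) = - starRingEnd ℂ (ghat t c z) := by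
  have h (w : ℂ) (hw : w.im ≠ 0) :
      (starRingEnd ℂ w) ^ ((1:ℂ)/2) = starRingEnd ℂ (w ^ ((1:ℂ)/2)) := by
    have h0 : w.arg ≠ Real.pi := fun h => hw (Complex.arg_eq_pi_iff.1 h).2
    rw [Complex.conj_cpow _ _ h0]
    have : starRingEnd ℂ ((1:ℂ)/2) = 1/2 := by
      rw [map_div₀, map_one, map_ofNat]
    rw [this]
  have h1 := h (z - 1) (by simpa using hz)
  have h2 := h (z + 1) (by simpa using hz)
  unfold ghat rfun
  simp only [map_mul, map_add, map_div₀, map_pow, Complex.conj_ofReal, Complex.conj_I,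
    map_ofNat, ← h1, ← h2, map_sub, map_one]
  ring

lemma ghat_plus (t c x0 : ℝ) (hx : x0 ∈ Set.Ioo (-1:ℝ) 1) :
    Tendsto (fun ε : ℝ => ghat t c ((x0:ℂ) + (ε:ℂ) * Complex.I))
        (nhdsWithin 0 (Set.Ioi 0))
        (nhds ((-(4/3) * Real.sqrt (1 - x0^2) * (t*x0^2 + t/2 + c) : ℝ) : ℂ)) := by
  obtain ⟨hx1, hx2⟩ := hx
  have hz : Tendsto (fun ε : ℝ => (x0:ℂ) + (ε:ℂ) * Complex.I) (nhdsWithin 0 (Set.Ioi 0))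
      (nhds (x0:ℂ)) := by
    have : Continuous (fun ε : ℝ => (x0:ℂ) + (ε:ℂ) * Complex.I) := by fun_prop
    have h := this.tendsto 0
    simp only [Complex.ofReal_zero, zero_mul, add_zero] at h
    exact h.mono_left nhdsWithin_le_nhds
  have hp : Tendsto (fun ε : ℝ => ((x0:ℂ) + (ε:ℂ) * Complex.I + 1) ^ ((1:ℂ)/2))
      (nhdsWithin 0 (Set.Ioi 0)) (nhds ((Real.sqrt (1 + x0) : ℝ) : ℂ)) := by
    have hc : ContinuousAt (fun w : ℂ => (w + 1) ^ ((1:ℂ)/2)) (x0:ℂ) := by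
      apply ContinuousAt.cpow (by fun_prop) continuousAt_const
      left
      simp
      linarith
    have h := hc.tendsto.comp hz
    have e : ((Real.sqrt (1 + x0) : ℝ) : ℂ) = ((x0:ℂ) + 1) ^ ((1:ℂ)/2) := by
      rw [Real.sqrt_eq_rpow, Complex.ofReal_cpow (by linarith)]
      push_cast
      rw [add_comm]
    rw [e]
    exact h
  have hm : Tendsto (fun ε : ℝ => ((x0:ℂ) + (ε:ℂ) * Complex.I - 1) ^ ((1:ℂ)/2))
      (nhdsWithin 0 (Set.Ioi 0)) (nhds (((Real.sqrt (1 - x0) : ℝ) : ℂ) * Complex.I)) := by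
    have hl := Complex.continuousWithinAt_log_of_re_neg_of_im_zero (z := (x0:ℂ) - 1)
      (by simp; linarith) (by simp)
    have ht : Tendsto (fun ε : ℝ => (x0:ℂ) + (ε:ℂ) * Complex.I - 1) (nhdsWithin 0 (Set.Ioi 0))
        (nhdsWithin ((x0:ℂ) - 1) {z : ℂ | 0 ≤ z.im}) := by
      apply tendsto_nhdsWithin_iff.2
      refine ⟨hz.sub_const 1, ?_⟩
      filter_upwards [self_mem_nhdsWithin] with ε hε
      simpa using le_of_lt hε
    have h := (Complex.continuous_exp.tendsto _).comp ((hl.tendsto.comp ht).mul_const ((1:ℂ)/2))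
    have hv : Complex.exp (Complex.log ((x0:ℂ) - 1) * (1/2)) =
        ((Real.sqrt (1 - x0) : ℝ) : ℂ) * Complex.I := by
      have e : (x0:ℂ) - 1 = -((1 - x0 : ℝ) : ℂ) := by push_cast; ring
      have hn : (x0:ℂ) - 1 ≠ 0 := by
        rw [e, neg_ne_zero]; exact_mod_cast (by linarith : (1 - x0) ≠ 0)
      have e2 : Complex.log ((x0:ℂ) - 1) = ((Real.log (1 - x0) : ℝ) : ℂ) + Real.pi * Complex.I := by
        have ha : (-((1 - x0 : ℝ) : ℂ)).arg = Real.pi := by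
          rw [← Complex.ofReal_neg]
          exact Complex.arg_ofReal_of_neg (by linarith)
        rw [e, Complex.log, ha, norm_neg,
          Complex.norm_real, Real.norm_of_nonneg (by linarith)]
      rw [e2, Real.sqrt_eq_rpow, Real.rpow_def_of_pos (by linarith), add_mul, Complex.exp_add]
      have : (Real.pi:ℂ) * Complex.I * (1/2) = Real.pi / 2 * Complex.I := by ring
      rw [this, Complex.exp_pi_div_two_mul_I]
      push_cast
      rfl
    rw [hv] at h
    refine h.congr' ?_
    filter_upwards [self_mem_nhdsWithin] with ε hε
    have hne : (x0:ℂ) + (ε:ℂ) * Complex.I - 1 ≠ 0 := by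
      intro h
      have := congrArg Complex.im h
      simp at this
      exact (ne_of_gt hε) this
    simp only [Function.comp]
    rw [Complex.cpow_def_of_ne_zero hne]
  have hq : Tendsto (fun ε : ℝ => (t:ℂ) * ((x0:ℂ) + (ε:ℂ) * Complex.I)^2 + (t:ℂ)/2 + (c:ℂ))
      (nhdsWithin 0 (Set.Ioi 0)) (nhds ((t:ℂ) * (x0:ℂ)^2 + (t:ℂ)/2 + (c:ℂ))) :=
    (((hz.pow 2).const_mul _).add_const _).add_const _
  have h := ((hm.mul hp).const_mul (4*Complex.I/3)).mul hq
  have e : ((-(4/3) * Real.sqrt (1 - x0^2) * (t*x0^2 + t/2 + c) : ℝ) : ℂ) =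
      4 * Complex.I / 3 * (((Real.sqrt (1 - x0) : ℝ) : ℂ) * Complex.I *
        ((Real.sqrt (1 + x0) : ℝ) : ℂ)) * ((t:ℂ) * (x0:ℂ)^2 + (t:ℂ)/2 + (c:ℂ)) := by
    have : 1 - x0^2 = (1 - x0) * (1 + x0) := by ring
    rw [this, Real.sqrt_mul (by linarith)]
    push_cast
    linear_combination (-(4/3) * (Real.sqrt (1 - x0):ℂ) * (Real.sqrt (1 + x0):ℂ)
      * ((t:ℂ) * (x0:ℂ)^2 + (t:ℂ)/2 + (c:ℂ))) * Complex.I_sq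
  rw [e]
  exact h

/-- Properties of the g-function of the cubic sine kernel steepest-descent analysis:
holomorphy off `[-1,1]`, `r(z)/z → 1` at infinity, odd boundary values with negative
real upper boundary value on `(-1,1)`, and normalization `ĝ(z) - i((4/3)tz³ + (4/3)cz) → 0`
at infinity. -/
theorem gfunction_properties (t c : ℝ) (ht : 0 ≤ t) (hc : 0 < t/2 + c) :
    -- (i) holomorphy and behavior of r at infinity
    (DifferentiableOn ℂ rfun Cutᶜ ∧ DifferentiableOn ℂ (ghat t c) Cutᶜ ∧
      Tendsto (fun z => rfun z / z) (Bornology.cobounded ℂ) (nhds 1)) ∧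
    -- (ii) boundary values on (-1,1)
    (∀ x0 ∈ Set.Ioo (-1:ℝ) 1, ∃ gp gm : ℂ,
      Tendsto (fun ε : ℝ => ghat t c ((x0:ℂ) + (ε:ℂ) * Complex.I))
        (nhdsWithin 0 (Set.Ioi 0)) (nhds gp) ∧
      Tendsto (fun ε : ℝ => ghat t c ((x0:ℂ) - (ε:ℂ) * Complex.I))
        (nhdsWithin 0 (Set.Ioi 0)) (nhds gm) ∧
      gp + gm = 0 ∧
      gp = ((-(4/3) * Real.sqrt (1 - x0^2) * (t*x0^2 + t/2 + c) : ℝ) : ℂ) ∧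
      -(4/3) * Real.sqrt (1 - x0^2) * (t*x0^2 + t/2 + c) < 0) ∧
    -- (iii) normalization at infinity
    Tendsto (fun z : ℂ => ghat t c z - Complex.I * ((4/3)*(t:ℂ)*z^3 + (4/3)*(c:ℂ)*z))
      (Bornology.cobounded ℂ) (nhds 0) := by
  refine ⟨⟨rfun_diff, ?_, rfun_tend⟩, ?_, ghat_tend t c⟩
  · unfold ghat
    exact (rfun_diff.const_mul _).mul (by fun_prop)
  · intro x0 hx
    have hp := ghat_plus t c x0 hx
    refine ⟨_, -((-(4/3) * Real.sqrt (1 - x0^2) * (t*x0^2 + t/2 + c) : ℝ) : ℂ), hp, ?_,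
      add_neg_cancel _, rfl, ?_⟩
    · have h := ((Complex.continuous_conj.tendsto _).comp hp).neg
      rw [Complex.conj_ofReal] at h
      refine h.congr' ?_
      filter_upwards [self_mem_nhdsWithin] with ε hε
      simp only [Function.comp]
      rw [← ghat_conj t c _ (by simpa using ne_of_gt hε)]
      congr 1
      simp [sub_eq_add_neg]
    · have h1 : 0 < Real.sqrt (1 - x0^2) := Real.sqrt_pos.2 (by nlinarith [hx.1, hx.2])
      have h2 : 0 < t*x0^2 + t/2 + c := by nlinarith [mul_nonneg ht (sq_nonneg x0)]
      have := mul_pos h1 h2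
      linarith

end
end
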